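/- arXiv:1503.06655 — 5 statements merged into one kernel-verified Lean document; each statement's English description precedes it below -/
import Mathlib

section
/- Let h(t) = f(t)·χ_Ω(t), where f is a C^∞ function on ℝ² that is ℤ²-periodic and χ_Ω is the characteristic function of a bounded Borel set Ω ⊆ ℝ². Define V(f) = 4‖f‖_{L¹(T²)} + 2‖∂f/∂t₁‖_{L¹(T²)} + 2‖∂f/∂t₂‖_{L¹(T²)} + ‖∂²f/∂t₁∂t₂‖_{L¹(T²)} (all L¹ norms over a fundamental domain [0,1]²). Let {t(j)}_{j=1}^N ⊂ ℝ², and let D({t(j)}_{j=1}^N) be the discrepancy of this point set relative to Ω. Then |N^{-1} Σ_{j=1}^N Σ_{m∈ℤ²} h(t(j)+m) − ∫_{ℝ²} h(t) dt| ≤ V(f) · D({t(j)}_{j=1}^N). -/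
open MeasureTheory

/-- The periodized rectangle `I(s,x) = ⋃_{m ∈ ℤ²} ([0,s₁] × [0,s₂] + x + m)`. -/
def periodizedRect (s x : ℝ × ℝ) : Set (ℝ × ℝ) :=
  ⋃ m : ℤ × ℤ,
    Set.Icc (x.1 + m.1) (x.1 + m.1 + s.1) ×ˢ Set.Icc (x.2 + m.2) (x.2 + m.2 + s.2)

/-- The indicator, as a function of `(s, u, t)`, of `t` lying in the periodized arc
`[u, u + s] + ℤ`. -/
noncomputable def arcIndicator (s u t : ℝ) : ℝ :=
  Set.indicator {p : ℝ × ℝ × ℝ | ∃ m : ℤ, p.2.1 + m ≤ p.2.2 ∧ p.2.2 ≤ p.2.1 + m + p.1}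
    (fun _ => (1 : ℝ)) (s, u, t)

/-- Lebesgue measure on the open unit interval. -/
noncomputable def unitMeasure : Measure ℝ := volume.restrict (Set.Ioo 0 1)

instance : IsProbabilityMeasure unitMeasure := ⟨by simp [unitMeasure]⟩

theorem measurable_arcIndicator :
    Measurable fun p : ℝ × ℝ × ℝ => arcIndicator p.1 p.2.1 p.2.2 := by
  unfold arcIndicator
  refine measurable_const.indicator ?_
  simp only [Set.ofPred_exists]
  refine MeasurableSet.iUnion fun m => ?_
  have h1 : Measurable fun p : ℝ × ℝ × ℝ => p.2.1 + (m : ℝ) := by fun_prop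
  have h2 : Measurable fun p : ℝ × ℝ × ℝ => p.2.2 := by fun_prop
  exact (measurableSet_le h1 h2).inter (measurableSet_le h2 (h1.add measurable_fst))

theorem Measurable.arcIndicator {α : Type*} [MeasurableSpace α] {a b c : α → ℝ}
    (ha : Measurable a) (hb : Measurable b) (hc : Measurable c) :
    Measurable fun x => arcIndicator (a x) (b x) (c x) :=
  measurable_arcIndicator.comp (ha.prodMk (hb.prodMk hc))

theorem norm_arcIndicator_le_one (s u t : ℝ) : ‖arcIndicator s u t‖ ≤ 1 := by
  classical
  rw [arcIndicator, Set.indicator_apply]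
  split_ifs <;> simp

theorem indicator_periodizedRect (s x p : ℝ × ℝ) :
    (periodizedRect s x).indicator (fun _ => (1 : ℝ)) p
      = arcIndicator s.1 x.1 p.1 * arcIndicator s.2 x.2 p.2 := by
  have hmem : p ∈ periodizedRect s x ↔
      (∃ m : ℤ, x.1 + m ≤ p.1 ∧ p.1 ≤ x.1 + m + s.1) ∧
        ∃ m : ℤ, x.2 + m ≤ p.2 ∧ p.2 ≤ x.2 + m + s.2 := by
    simp only [periodizedRect, Set.mem_iUnion, Set.mem_prod, Set.mem_Icc, Prod.exists]
    constructor
    · rintro ⟨a, b, h1, h2⟩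
      exact ⟨⟨a, h1⟩, ⟨b, h2⟩⟩
    · rintro ⟨⟨a, h1⟩, ⟨b, h2⟩⟩
      exact ⟨a, b, h1, h2⟩
  classical
  simp only [arcIndicator, Set.indicator_apply, Set.mem_ofPred_eq, hmem]
  split_ifs <;> simp_all

theorem measurableSet_periodizedRect (s x : ℝ × ℝ) : MeasurableSet (periodizedRect s x) :=
  MeasurableSet.iUnion fun _ => measurableSet_Icc.prod measurableSet_Icc

theorem integral_unitMeasure (g : ℝ → ℝ) :
    ∫ u, g u ∂unitMeasure = ∫ u in (0 : ℝ)..1, g u := by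
  rw [intervalIntegral.integral_of_le zero_le_one, integral_Ioc_eq_integral_Ioo, unitMeasure]

theorem unitMeasure_prod_unitMeasure :
    unitMeasure.prod unitMeasure
      = (volume : Measure (ℝ × ℝ)).restrict (Set.Icc 0 1 ×ˢ Set.Icc 0 1) := by
  have h : unitMeasure = volume.restrict (Set.Icc (0 : ℝ) 1) :=
    Measure.restrict_congr_set Ioo_ae_eq_Icc
  rw [h, Measure.prod_restrict, Measure.volume_eq_prod]

theorem Continuous.integrable_unitMeasure_prod {g : ℝ × ℝ → ℝ} (hg : Continuous g) :
    Integrable g (unitMeasure.prod unitMeasure) := by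
  rw [unitMeasure_prod_unitMeasure]
  exact hg.continuousOn.integrableOn_compact (isCompact_Icc.prod isCompact_Icc)

theorem arcIndicator_add_one (s u t : ℝ) : arcIndicator s (u + 1) t = arcIndicator s u t := by
  have h : (∃ m : ℤ, u + 1 + m ≤ t ∧ t ≤ u + 1 + m + s) ↔
      ∃ m : ℤ, u + m ≤ t ∧ t ≤ u + m + s := by
    constructor
    · rintro ⟨m, h1, h2⟩
      exact ⟨m + 1, by push_cast; linarith, by push_cast; linarith⟩
    · rintro ⟨m, h1, h2⟩
      exact ⟨m - 1, by push_cast; linarith, by push_cast; linarith⟩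
  classical
  simp only [arcIndicator, Set.indicator_apply, Set.mem_ofPred_eq, h]

theorem intervalIntegral_arcIndicator_mul {g : ℝ → ℝ} (hper : Function.Periodic g 1)
    {s : ℝ} (hs0 : 0 < s) (hs1 : s < 1) (t : ℝ) :
    ∫ u in (0 : ℝ)..1, arcIndicator s u t * g u = ∫ u in (t - s)..t, g u := by
  have hp : Function.Periodic (fun u => arcIndicator s u t * g u) 1 := fun u => by
    simp only [arcIndicator_add_one, hper u]
  have h1 := hp.intervalIntegral_add_eq 0 (t - 1)
  rw [zero_add, sub_add_cancel] at h1
  rw [h1, intervalIntegral.integral_of_le (by linarith), intervalIntegral.integral_of_le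
    (by linarith), ← integral_Icc_eq_integral_Ioc (x := t - s),
    ← Set.inter_eq_self_of_subset_right (s := Set.Ioc (t - 1) t) (t := Set.Icc (t - s) t)
      (fun u hu => ⟨by linarith [hu.1], hu.2⟩),
    ← setIntegral_indicator measurableSet_Icc]
  refine setIntegral_congr_fun measurableSet_Ioc fun u hu => ?_
  classical
  have h : (∃ m : ℤ, u + m ≤ t ∧ t ≤ u + m + s) ↔ u ∈ Set.Icc (t - s) t := by
    constructor
    · rintro ⟨m, h1, h2⟩
      have hm1 : (m : ℝ) < 1 := by linarith [hu.1]
      have hm2 : (-1 : ℝ) < m := by linarith [hu.2]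
      have hm : m = 0 := by
        have h3 : m < 1 := by exact_mod_cast hm1
        have h4 : -1 < m := by exact_mod_cast hm2
        omega
      subst hm
      simp only [Int.cast_zero, add_zero] at h1 h2
      exact ⟨by linarith, h1⟩
    · rintro ⟨h1, h2⟩
      exact ⟨0, by simpa using h2, by simp only [Int.cast_zero]; linarith⟩
  simp only [arcIndicator, Set.indicator_apply, Set.mem_ofPred_eq, h]
  split_ifs <;> simp

theorem integrable_arcIndicator_mul {α : Type*} [MeasurableSpace α] {μ : Measure α}
    {a b c w : α → ℝ} (ha : Measurable a) (hb : Measurable b) (hc : Measurable c)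
    (hw : Integrable w μ) :
    Integrable (fun x => arcIndicator (a x) (b x) (c x) * w x) μ :=
  hw.bdd_mul (ha.arcIndicator hb hc).aestronglyMeasurable
    (Filter.Eventually.of_forall fun _ => norm_arcIndicator_le_one _ _ _)

theorem integrable_comp_snd {g : ℝ → ℝ} (hg : Continuous g) :
    Integrable (fun q : ℝ × ℝ => g q.2) (unitMeasure.prod unitMeasure) :=
  (hg.comp continuous_snd).integrable_unitMeasure_prod

/-- A periodic `C¹` function is a superposition of indicators of periodized arcs. -/
theorem eq_integral_arcIndicator {φ φ' : ℝ → ℝ} (hφ : Function.Periodic φ 1)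
    (hd : ∀ x, HasDerivAt φ (φ' x) x) (hc : Continuous φ') (t : ℝ) :
    φ t = (∫ q, arcIndicator q.1 q.2 t * φ' q.2 ∂(unitMeasure.prod unitMeasure))
      + ∫ q, arcIndicator (1 / 2) q.2 t * (φ q.2 + φ (q.2 + 1 / 2))
          ∂(unitMeasure.prod unitMeasure) := by
  have hφc : Continuous φ := continuous_iff_continuousAt.2 fun x => (hd x).continuousAt
  have hint : ∀ a b, IntervalIntegrable φ volume a b := fun a b => hφc.intervalIntegrable a b
  have hφ' : Function.Periodic φ' 1 := fun x => by
    have h1 := (hd (x + 1)).comp_add_const x 1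
    have h2 : (fun y => φ (y + 1)) = φ := funext hφ
    rw [h2] at h1
    exact h1.unique (hd x)
  have e1 : (∫ q, arcIndicator q.1 q.2 t * φ' q.2 ∂(unitMeasure.prod unitMeasure))
      = φ t - ∫ x in (0 : ℝ)..1, φ x := by
    rw [integral_prod _ (integrable_arcIndicator_mul measurable_fst measurable_snd
      measurable_const (integrable_comp_snd hc))]
    have h1 : ∫ s, (∫ u, arcIndicator s u t * φ' u ∂unitMeasure) ∂unitMeasure
        = ∫ s, (φ t - φ (t - s)) ∂unitMeasure := by
      refine setIntegral_congr_fun measurableSet_Ioo fun s hs => ?_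
      simp only [integral_unitMeasure]
      rw [intervalIntegral_arcIndicator_mul hφ' hs.1 hs.2,
        intervalIntegral.integral_eq_sub_of_hasDerivAt (fun x _ => hd x)
          (hc.intervalIntegrable _ _)]
    have hct : Continuous fun x => φ (t - x) := by fun_prop
    rw [h1, integral_unitMeasure, intervalIntegral.integral_sub
      (by simp) (hct.intervalIntegrable _ _),
      intervalIntegral.integral_comp_sub_left (fun x => φ x) t]
    have h2 := hφ.intervalIntegral_add_eq 0 (t - 1)
    simp only [zero_add, sub_add_cancel] at h2
    simp [h2]
  have e2 : ∫ q, arcIndicator (1 / 2) q.2 t * (φ q.2 + φ (q.2 + 1 / 2))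
      ∂(unitMeasure.prod unitMeasure) = ∫ x in (0 : ℝ)..1, φ x := by
    have hc2 : Continuous fun u => φ (u + 1 / 2) := hφc.comp (continuous_id.add continuous_const)
    have hp2 : Function.Periodic (fun u => φ u + φ (u + 1 / 2)) 1 := fun u => by
      simp only [hφ u]
      rw [add_right_comm u 1, hφ]
    have hc3 : Continuous fun u => φ u + φ (u + 1 / 2) := hφc.add hc2
    rw [integral_prod _ (integrable_arcIndicator_mul measurable_const measurable_snd
      measurable_const (integrable_comp_snd hc3))]
    simp only [integral_unitMeasure]
    rw [intervalIntegral_arcIndicator_mul hp2 (by norm_num) (by norm_num),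
      intervalIntegral.integral_add (hint _ _) (hc2.intervalIntegrable _ _),
      intervalIntegral.integral_comp_add_right (fun x => φ x), sub_add_cancel,
      intervalIntegral.integral_add_adjacent_intervals (hint _ _) (hint _ _)]
    have h2 := hφ.intervalIntegral_add_eq 0 (t - 1 / 2)
    rw [zero_add, show t - 1 / 2 + 1 = t + 1 / 2 by ring] at h2
    simp [h2]
  rw [e1, e2]
  ring

theorem integrable_prod_arcIndicator {Θ : Type*} [MeasurableSpace Θ] {κ : Measure Θ}
    [IsFiniteMeasure κ] {ν : Measure (ℝ × ℝ)} [IsFiniteMeasure ν] {σ ξ : Θ → ℝ × ℝ}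
    (hσ : Measurable σ) (hξ : Measurable ξ) {w : Θ → ℝ} (hw : Integrable w κ) :
    Integrable (fun z : (ℝ × ℝ) × Θ => arcIndicator (σ z.2).1 (ξ z.2).1 z.1.1
      * (arcIndicator (σ z.2).2 (ξ z.2).2 z.1.2 * w z.2)) (ν.prod κ) :=
  integrable_arcIndicator_mul (by fun_prop) (by fun_prop) (by fun_prop)
    (integrable_arcIndicator_mul (by fun_prop) (by fun_prop) (by fun_prop) (hw.comp_snd ν))

theorem integral_integral_arcIndicator {Θ : Type*} [MeasurableSpace Θ] {κ : Measure Θ}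
    [IsFiniteMeasure κ] {ν : Measure (ℝ × ℝ)} [IsFiniteMeasure ν] {σ ξ : Θ → ℝ × ℝ}
    (hσ : Measurable σ) (hξ : Measurable ξ) {w : Θ → ℝ} (hw : Integrable w κ) :
    Integrable (fun θ => ν.real (periodizedRect (σ θ) (ξ θ)) * w θ) κ ∧
    ∫ p, ∫ θ, arcIndicator (σ θ).1 (ξ θ).1 p.1
      * (arcIndicator (σ θ).2 (ξ θ).2 p.2 * w θ) ∂κ ∂ν
      = ∫ θ, ν.real (periodizedRect (σ θ) (ξ θ)) * w θ ∂κ := by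
  have hI := integrable_prod_arcIndicator (ν := ν) hσ hξ hw
  have h1 : ∀ θ, ∫ p, arcIndicator (σ θ).1 (ξ θ).1 p.1
      * (arcIndicator (σ θ).2 (ξ θ).2 p.2 * w θ) ∂ν
      = ν.real (periodizedRect (σ θ) (ξ θ)) * w θ := fun θ => by
    simp only [← mul_assoc, ← indicator_periodizedRect]
    rw [integral_mul_const, integral_indicator (measurableSet_periodizedRect _ _)]
    simp
  constructor
  · simpa only [h1] using hI.integral_prod_right
  · rw [integral_integral_swap hI]
    simp only [h1]

/-- If two finite measures differ by at most `D` on periodized rectangles, their integrals of a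
superposition of periodized rectangles differ by at most `D` times the total weight. -/
theorem abs_integral_sub_integral_superposition_le {Θ : Type*} [MeasurableSpace Θ]
    {κ : Measure Θ} [IsFiniteMeasure κ] {ν₁ ν₂ : Measure (ℝ × ℝ)} [IsFiniteMeasure ν₁]
    [IsFiniteMeasure ν₂] {D : ℝ}
    (hD : ∀ s : ℝ × ℝ, 0 < s.1 → s.1 < 1 → 0 < s.2 → s.2 < 1 → ∀ x : ℝ × ℝ,
      |ν₁.real (periodizedRect s x) - ν₂.real (periodizedRect s x)| ≤ D)
    {σ ξ : Θ → ℝ × ℝ} (hσ : Measurable σ) (hξ : Measurable ξ)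
    (hσ' : ∀ᵐ θ ∂κ, σ θ ∈ Set.Ioo (0 : ℝ) 1 ×ˢ Set.Ioo (0 : ℝ) 1)
    {w : Θ → ℝ} (hw : Integrable w κ) :
    |(∫ p, ∫ θ, arcIndicator (σ θ).1 (ξ θ).1 p.1
        * (arcIndicator (σ θ).2 (ξ θ).2 p.2 * w θ) ∂κ ∂ν₁)
      - ∫ p, ∫ θ, arcIndicator (σ θ).1 (ξ θ).1 p.1
        * (arcIndicator (σ θ).2 (ξ θ).2 p.2 * w θ) ∂κ ∂ν₂| ≤ (∫ θ, |w θ| ∂κ) * D := by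
  obtain ⟨i1, e1⟩ := integral_integral_arcIndicator (ν := ν₁) hσ hξ hw
  obtain ⟨i2, e2⟩ := integral_integral_arcIndicator (ν := ν₂) hσ hξ hw
  rw [e1, e2, ← integral_sub i1 i2, ← integral_mul_const, ← Real.norm_eq_abs]
  refine norm_integral_le_of_norm_le (hw.abs.mul_const D) ?_
  filter_upwards [hσ'] with θ hθ
  rw [← sub_mul, norm_mul, mul_comm, Real.norm_eq_abs, Real.norm_eq_abs]
  exact mul_le_mul_of_nonneg_left (hD _ hθ.1.1 hθ.1.2 hθ.2.1 hθ.2.2 _) (abs_nonneg _)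

theorem integral_comp_add_snd {g : ℝ × ℝ → ℝ} (hg : Continuous g)
    (hper : ∀ x y, g (x, y + 1) = g (x, y)) (c : ℝ) :
    ∫ u, g (u.1, u.2 + c) ∂(unitMeasure.prod unitMeasure)
      = ∫ u, g u ∂(unitMeasure.prod unitMeasure) := by
  have hgc : Continuous fun u : ℝ × ℝ => g (u.1, u.2 + c) := by fun_prop
  rw [integral_prod _ hgc.integrable_unitMeasure_prod,
    integral_prod _ hg.integrable_unitMeasure_prod]
  refine integral_congr_ae (Filter.Eventually.of_forall fun x => ?_)
  have hp : Function.Periodic (fun y => g (x, y)) 1 := fun y => hper x y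
  have h := hp.intervalIntegral_add_eq c 0
  simp only [zero_add] at h
  simp only [integral_unitMeasure]
  rw [intervalIntegral.integral_comp_add_right (fun y => g (x, y)), zero_add, add_comm 1 c, h]

theorem integral_abs_add_shift_snd_le {g : ℝ × ℝ → ℝ} (hg : Continuous g)
    (hper : ∀ x y, g (x, y + 1) = g (x, y)) (c : ℝ) :
    ∫ u, |g u + g (u.1, u.2 + c)| ∂(unitMeasure.prod unitMeasure)
      ≤ 2 * ∫ u, |g u| ∂(unitMeasure.prod unitMeasure) := by
  have hgc : Continuous fun u : ℝ × ℝ => g (u.1, u.2 + c) := by fun_prop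
  have i1 := hg.abs.integrable_unitMeasure_prod
  have i2 := hgc.abs.integrable_unitMeasure_prod
  calc ∫ u, |g u + g (u.1, u.2 + c)| ∂(unitMeasure.prod unitMeasure)
      ≤ ∫ u, (|g u| + |g (u.1, u.2 + c)|) ∂(unitMeasure.prod unitMeasure) :=
        integral_mono (hg.add hgc).abs.integrable_unitMeasure_prod (i1.add i2)
          fun u => abs_add_le _ _
    _ = 2 * ∫ u, |g u| ∂(unitMeasure.prod unitMeasure) := by
        rw [integral_add i1 i2, integral_comp_add_snd (g := fun u => |g u|) hg.abs
          (fun x y => by simp only [hper]) c, two_mul]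

theorem integral_abs_add_shift_fst_le {g : ℝ × ℝ → ℝ} (hg : Continuous g)
    (hper : ∀ x y, g (x + 1, y) = g (x, y)) (c : ℝ) :
    ∫ u, |g u + g (u.1 + c, u.2)| ∂(unitMeasure.prod unitMeasure)
      ≤ 2 * ∫ u, |g u| ∂(unitMeasure.prod unitMeasure) := by
  have h := integral_abs_add_shift_snd_le (g := fun u => g u.swap) (by fun_prop)
    (fun x y => hper y x) c
  rw [integral_prod_swap (fun u => |g u|)] at h
  rw [← integral_prod_swap]
  exact h

theorem measurePreserving_snd_snd :
    MeasurePreserving (fun θ : (ℝ × ℝ) × (ℝ × ℝ) => (θ.1.2, θ.2.2))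
      ((unitMeasure.prod unitMeasure).prod (unitMeasure.prod unitMeasure))
      (unitMeasure.prod unitMeasure) :=
  measurePreserving_snd.prod measurePreserving_snd

theorem integral_comp_snd_snd {g : ℝ × ℝ → ℝ} (hg : Continuous g) :
    ∫ θ, g (θ.1.2, θ.2.2)
      ∂((unitMeasure.prod unitMeasure).prod (unitMeasure.prod unitMeasure))
      = ∫ u, g u ∂(unitMeasure.prod unitMeasure) := by
  conv_rhs => rw [← measurePreserving_snd_snd.map_eq]
  rw [integral_map (by fun_prop) hg.aestronglyMeasurable]

theorem ae_unitMeasure_mem : ∀ᵐ s ∂unitMeasure, s ∈ Set.Ioo (0 : ℝ) 1 :=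
  ae_restrict_mem measurableSet_Ioo

/-- The superposition of strips `arcIndicator (σ s) u p.1` with weights `G (u, p.2)`. -/
noncomputable def stripSuperposition (σ : ℝ → ℝ) (G : ℝ × ℝ → ℝ) (p : ℝ × ℝ) : ℝ :=
  ∫ q, arcIndicator (σ q.1) q.2 p.1 * G (q.2, p.2) ∂(unitMeasure.prod unitMeasure)

/-- The superposition of rectangles with side lengths `σ s₁, τ s₂` and weights `w`. -/
noncomputable def rectSuperposition (σ τ : ℝ → ℝ) (w : ℝ × ℝ → ℝ) (p : ℝ × ℝ) : ℝ :=
  ∫ θ, arcIndicator (σ θ.1.1) θ.1.2 p.1 * (arcIndicator (τ θ.2.1) θ.2.2 p.2 * w (θ.1.2, θ.2.2))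
    ∂((unitMeasure.prod unitMeasure).prod (unitMeasure.prod unitMeasure))

section Superposition

variable {σ τ : ℝ → ℝ} {w : ℝ × ℝ → ℝ}

theorem Continuous.integrable_comp_snd_snd (hw : Continuous w) :
    Integrable (fun θ : (ℝ × ℝ) × (ℝ × ℝ) => w (θ.1.2, θ.2.2))
      ((unitMeasure.prod unitMeasure).prod (unitMeasure.prod unitMeasure)) :=
  measurePreserving_snd_snd.integrable_comp_of_integrable hw.integrable_unitMeasure_prod

theorem rectSuperposition_eq (hσ : Measurable σ) (hτ : Measurable τ) (hw : Continuous w)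
    (p : ℝ × ℝ) :
    Integrable (fun q : ℝ × ℝ => arcIndicator (σ q.1) q.2 p.1 *
      ∫ r, arcIndicator (τ r.1) r.2 p.2 * w (q.2, r.2) ∂(unitMeasure.prod unitMeasure))
      (unitMeasure.prod unitMeasure) ∧
    rectSuperposition σ τ w p = ∫ q, arcIndicator (σ q.1) q.2 p.1 *
      ∫ r, arcIndicator (τ r.1) r.2 p.2 * w (q.2, r.2) ∂(unitMeasure.prod unitMeasure)
      ∂(unitMeasure.prod unitMeasure) := by
  have hI : Integrable (fun θ : (ℝ × ℝ) × (ℝ × ℝ) => arcIndicator (σ θ.1.1) θ.1.2 p.1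
      * (arcIndicator (τ θ.2.1) θ.2.2 p.2 * w (θ.1.2, θ.2.2)))
      ((unitMeasure.prod unitMeasure).prod (unitMeasure.prod unitMeasure)) :=
    integrable_arcIndicator_mul (by fun_prop) (by fun_prop) (by fun_prop)
      (integrable_arcIndicator_mul (by fun_prop) (by fun_prop) (by fun_prop)
        hw.integrable_comp_snd_snd)
  constructor
  · simpa only [integral_const_mul] using hI.integral_prod_left
  · rw [rectSuperposition, integral_prod _ hI]
    simp only [integral_const_mul]

theorem integrable_rectSuperposition (hσ : Measurable σ) (hτ : Measurable τ)
    (hw : Continuous w) (ν : Measure (ℝ × ℝ)) [IsFiniteMeasure ν] :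
    Integrable (rectSuperposition σ τ w) ν :=
  (integrable_prod_arcIndicator (ν := ν)
    (σ := fun θ : (ℝ × ℝ) × (ℝ × ℝ) => (σ θ.1.1, τ θ.2.1)) (ξ := fun θ => (θ.1.2, θ.2.2))
    (by fun_prop) (by fun_prop) hw.integrable_comp_snd_snd).integral_prod_left

variable {ν₁ ν₂ : Measure (ℝ × ℝ)} [IsFiniteMeasure ν₁] [IsFiniteMeasure ν₂] {D : ℝ}

theorem abs_integral_sub_integral_rectSuperposition_le
    (hD : ∀ s : ℝ × ℝ, 0 < s.1 → s.1 < 1 → 0 < s.2 → s.2 < 1 → ∀ x : ℝ × ℝ,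
      |ν₁.real (periodizedRect s x) - ν₂.real (periodizedRect s x)| ≤ D)
    (hσ : Measurable σ) (hτ : Measurable τ) (hσ' : ∀ s ∈ Set.Ioo (0 : ℝ) 1, σ s ∈ Set.Ioo (0 : ℝ) 1)
    (hτ' : ∀ s ∈ Set.Ioo (0 : ℝ) 1, τ s ∈ Set.Ioo (0 : ℝ) 1) (hw : Continuous w) :
    |∫ p, rectSuperposition σ τ w p ∂ν₁ - ∫ p, rectSuperposition σ τ w p ∂ν₂|
      ≤ (∫ u, |w u| ∂(unitMeasure.prod unitMeasure)) * D := by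
  rw [← integral_comp_snd_snd hw.abs]
  refine abs_integral_sub_integral_superposition_le hD
    (σ := fun θ : (ℝ × ℝ) × (ℝ × ℝ) => (σ θ.1.1, τ θ.2.1)) (ξ := fun θ => (θ.1.2, θ.2.2))
    (by fun_prop) (by fun_prop) ?_ hw.integrable_comp_snd_snd
  have h1 : ∀ᵐ q ∂(unitMeasure.prod unitMeasure), q.1 ∈ Set.Ioo (0 : ℝ) 1 :=
    Measure.quasiMeasurePreserving_fst.ae ae_unitMeasure_mem
  have h2 := (Measure.quasiMeasurePreserving_fst (μ := unitMeasure.prod unitMeasure)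
    (ν := unitMeasure.prod unitMeasure)).ae h1
  have h3 := (Measure.quasiMeasurePreserving_snd (μ := unitMeasure.prod unitMeasure)
    (ν := unitMeasure.prod unitMeasure)).ae h1
  filter_upwards [h2, h3] with θ a b
  exact ⟨hσ' _ a, hτ' _ b⟩

/-- A superposition of strips is a superposition of rectangles. -/
theorem stripSuperposition_eq (hσ : Measurable σ) {G G' : ℝ × ℝ → ℝ} (hG : Continuous G)
    (hG' : Continuous G') (hd : ∀ x y, HasDerivAt (fun y => G (x, y)) (G' (x, y)) y)
    (hper : ∀ x y, G (x, y + 1) = G (x, y)) (p : ℝ × ℝ) :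
    stripSuperposition σ G p = rectSuperposition σ id G' p
      + rectSuperposition σ (fun _ => 1 / 2) (fun u => G u + G (u.1, u.2 + 1 / 2)) p := by
  obtain ⟨i1, e1⟩ := rectSuperposition_eq hσ measurable_id hG' p
  obtain ⟨i2, e2⟩ := rectSuperposition_eq (τ := fun _ => 1 / 2)
    (w := fun u => G u + G (u.1, u.2 + 1 / 2)) hσ measurable_const (by fun_prop) p
  rw [e1, e2, ← integral_add i1 i2, stripSuperposition]
  refine integral_congr_ae (Filter.Eventually.of_forall fun q => ?_)
  have h := eq_integral_arcIndicator (φ := fun y => G (q.2, y)) (φ' := fun y => G' (q.2, y))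
    (fun y => hper q.2 y) (fun y => hd q.2 y) (by fun_prop) p.2
  simp only [← mul_add, id]
  rw [h]

theorem integrable_stripSuperposition (hσ : Measurable σ) {G G' : ℝ × ℝ → ℝ}
    (hG : Continuous G) (hG' : Continuous G')
    (hd : ∀ x y, HasDerivAt (fun y => G (x, y)) (G' (x, y)) y)
    (hper : ∀ x y, G (x, y + 1) = G (x, y)) (ν : Measure (ℝ × ℝ)) [IsFiniteMeasure ν] :
    Integrable (stripSuperposition σ G) ν := by
  rw [funext (stripSuperposition_eq hσ hG hG' hd hper)]
  exact (integrable_rectSuperposition hσ measurable_id hG' ν).add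
    (integrable_rectSuperposition hσ measurable_const (by fun_prop) ν)

theorem abs_integral_sub_integral_stripSuperposition_le
    (hD : ∀ s : ℝ × ℝ, 0 < s.1 → s.1 < 1 → 0 < s.2 → s.2 < 1 → ∀ x : ℝ × ℝ,
      |ν₁.real (periodizedRect s x) - ν₂.real (periodizedRect s x)| ≤ D)
    (hσ : Measurable σ) (hσ' : ∀ s ∈ Set.Ioo (0 : ℝ) 1, σ s ∈ Set.Ioo (0 : ℝ) 1)
    {G G' : ℝ × ℝ → ℝ} (hG : Continuous G) (hG' : Continuous G')
    (hd : ∀ x y, HasDerivAt (fun y => G (x, y)) (G' (x, y)) y)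
    (hper : ∀ x y, G (x, y + 1) = G (x, y)) :
    |∫ p, stripSuperposition σ G p ∂ν₁ - ∫ p, stripSuperposition σ G p ∂ν₂|
      ≤ ((∫ u, |G' u| ∂(unitMeasure.prod unitMeasure))
        + 2 * ∫ u, |G u| ∂(unitMeasure.prod unitMeasure)) * D := by
  have hD0 : 0 ≤ D := (abs_nonneg _).trans
    (hD (1 / 2, 1 / 2) (by norm_num) (by norm_num) (by norm_num) (by norm_num) 0)
  have hc : Continuous fun u : ℝ × ℝ => G u + G (u.1, u.2 + 1 / 2) := by fun_prop
  have b1 := abs_integral_sub_integral_rectSuperposition_le hD hσ measurable_id hσ'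
    (fun _ h => h) hG'
  have b2 := abs_integral_sub_integral_rectSuperposition_le hD hσ
    (measurable_const (a := (1 / 2 : ℝ))) hσ' (fun _ _ => by constructor <;> norm_num) hc
  have b3 := mul_le_mul_of_nonneg_right (integral_abs_add_shift_snd_le hG hper (1 / 2)) hD0
  simp only [stripSuperposition_eq hσ hG hG' hd hper]
  have hi : ∀ (ν : Measure (ℝ × ℝ)) [IsFiniteMeasure ν], _ := fun ν _ =>
    integral_add (integrable_rectSuperposition hσ measurable_id hG' ν)
      (integrable_rectSuperposition hσ (measurable_const (a := (1 / 2 : ℝ))) hc ν)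
  rw [hi ν₁, hi ν₂, add_sub_add_comm, add_mul]
  exact (abs_add_le _ _).trans (add_le_add b1 (b2.trans b3))

/-- Koksma–Hlawka inequality for two finite measures on the plane. -/
theorem abs_integral_sub_integral_le_of_discrepancy_le
    (hD : ∀ s : ℝ × ℝ, 0 < s.1 → s.1 < 1 → 0 < s.2 → s.2 < 1 → ∀ x : ℝ × ℝ,
      |ν₁.real (periodizedRect s x) - ν₂.real (periodizedRect s x)| ≤ D)
    {f : ℝ × ℝ → ℝ} (hf : ContDiff ℝ (⊤ : ℕ∞) f)
    (hper : ∀ (x : ℝ × ℝ) (m : ℤ × ℤ), f (x + ((m.1 : ℝ), (m.2 : ℝ))) = f x) :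
    |∫ p, f p ∂ν₁ - ∫ p, f p ∂ν₂|
      ≤ ((4 * ∫ u, |f u| ∂(unitMeasure.prod unitMeasure))
          + (2 * ∫ u, |fderiv ℝ f u (1, 0)| ∂(unitMeasure.prod unitMeasure))
          + (2 * ∫ u, |fderiv ℝ f u (0, 1)| ∂(unitMeasure.prod unitMeasure))
          + ∫ u, |fderiv ℝ (fun y => fderiv ℝ f y (1, 0)) u (0, 1)|
              ∂(unitMeasure.prod unitMeasure)) * D := by
  have hD0 : 0 ≤ D := (abs_nonneg _).trans
    (hD (1 / 2, 1 / 2) (by norm_num) (by norm_num) (by norm_num) (by norm_num) 0)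
  have hfst : ∀ {g : ℝ × ℝ → ℝ}, ContDiff ℝ (⊤ : ℕ∞) g → ∀ x y,
      HasDerivAt (fun x => g (x, y)) (fderiv ℝ g (x, y) (1, 0)) x := fun hg x y =>
    ((hg.differentiable (by simp)).differentiableAt (x := (x, y))).hasFDerivAt.comp_hasDerivAt x
      ((hasDerivAt_id x).prodMk (hasDerivAt_const x y))
  have hsnd : ∀ {g : ℝ × ℝ → ℝ}, ContDiff ℝ (⊤ : ℕ∞) g → ∀ x y,
      HasDerivAt (fun y => g (x, y)) (fderiv ℝ g (x, y) (0, 1)) y := fun hg x y =>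
    ((hg.differentiable (by simp)).differentiableAt (x := (x, y))).hasFDerivAt.comp_hasDerivAt y
      ((hasDerivAt_const y x).prodMk (hasDerivAt_id y))
  have hsmooth : ∀ {g : ℝ × ℝ → ℝ}, ContDiff ℝ (⊤ : ℕ∞) g → ∀ v : ℝ × ℝ,
      ContDiff ℝ (⊤ : ℕ∞) (fun u => fderiv ℝ g u v) := fun hg v =>
    (hg.fderiv_right (m := (⊤ : ℕ∞)) (by simp)).clm_apply contDiff_const
  have hp1 : ∀ x y, f (x + 1, y) = f (x, y) := fun x y => by simpa using hper (x, y) (1, 0)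
  have hp2 : ∀ x y, f (x, y + 1) = f (x, y) := fun x y => by simpa using hper (x, y) (0, 1)
  have hfd : ∀ (x : ℝ × ℝ) (m : ℤ × ℤ),
      fderiv ℝ f (x + ((m.1 : ℝ), (m.2 : ℝ))) = fderiv ℝ f x := fun x m => by
    rw [← fderiv_comp_add_right]
    simp only [hper]
  have hfd1 : ∀ x y, fderiv ℝ f (x + 1, y) = fderiv ℝ f (x, y) := fun x y => by
    simpa using hfd (x, y) (1, 0)
  have hfd2 : ∀ x y, fderiv ℝ f (x, y + 1) = fderiv ℝ f (x, y) := fun x y => by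
    simpa using hfd (x, y) (0, 1)
  have c0 : Continuous f := hf.continuous
  have c1 : Continuous fun u => fderiv ℝ f u (1, 0) := (hsmooth hf _).continuous
  have c2 : Continuous fun u => fderiv ℝ f u (0, 1) := (hsmooth hf _).continuous
  have c12 : Continuous fun u => fderiv ℝ (fun y => fderiv ℝ f y (1, 0)) u (0, 1) :=
    (hsmooth (hsmooth hf _) _).continuous
  have cG : Continuous fun u : ℝ × ℝ => f u + f (u.1 + 1 / 2, u.2) := by fun_prop
  have cG' : Continuous fun u : ℝ × ℝ =>
      fderiv ℝ f u (0, 1) + fderiv ℝ f (u.1 + 1 / 2, u.2) (0, 1) :=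
    c2.add (c2.comp (by fun_prop : Continuous fun u : ℝ × ℝ => (u.1 + 1 / 2, u.2)))
  have pG : ∀ x y, f (x, y + 1) + f (x + 1 / 2, y + 1) = f (x, y) + f (x + 1 / 2, y) :=
    fun x y => by rw [hp2, hp2]
  have dG : ∀ x y, HasDerivAt (fun y => f (x, y) + f (x + 1 / 2, y))
      (fderiv ℝ f (x, y) (0, 1) + fderiv ℝ f (x + 1 / 2, y) (0, 1)) y :=
    fun x y => (hsnd hf x y).add (hsnd hf (x + 1 / 2) y)
  have hhalf : ∀ s ∈ Set.Ioo (0 : ℝ) 1, (1 / 2 : ℝ) ∈ Set.Ioo (0 : ℝ) 1 :=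
    fun _ _ => by constructor <;> norm_num
  have b1 := abs_integral_sub_integral_stripSuperposition_le hD measurable_id
    (fun _ h => h) c1 c12 (hsnd (hsmooth hf (1, 0))) (fun x y => by rw [hfd2])
  have b2 := abs_integral_sub_integral_stripSuperposition_le hD
    (measurable_const (a := (1 / 2 : ℝ))) hhalf cG cG' dG pG
  have i1 : ∀ (ν : Measure (ℝ × ℝ)) [IsFiniteMeasure ν], _ := fun ν _ =>
    integrable_stripSuperposition measurable_id c1 c12 (hsnd (hsmooth hf (1, 0)))
      (fun x y => by rw [hfd2]) ν
  have i2 : ∀ (ν : Measure (ℝ × ℝ)) [IsFiniteMeasure ν], _ := fun ν _ =>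
    integrable_stripSuperposition (measurable_const (a := (1 / 2 : ℝ))) cG cG' dG pG ν
  have n0 := integral_abs_add_shift_fst_le c0 hp1 (1 / 2)
  have n2 := integral_abs_add_shift_fst_le c2 (fun x y => by rw [hfd1]) (1 / 2)
  have hrep : f = fun p => stripSuperposition id (fun u => fderiv ℝ f u (1, 0)) p
      + stripSuperposition (fun _ => 1 / 2) (fun u => f u + f (u.1 + 1 / 2, u.2)) p := by
    funext p
    exact eq_integral_arcIndicator (φ := fun x => f (x, p.2))
      (φ' := fun x => fderiv ℝ f (x, p.2) (1, 0)) (fun x => hp1 x p.2)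
      (fun x => hfst hf x p.2) (by fun_prop) p.1
  have hsplit : ∀ (ν : Measure (ℝ × ℝ)) [IsFiniteMeasure ν], ∫ p, f p ∂ν
      = ∫ p, stripSuperposition id (fun u => fderiv ℝ f u (1, 0)) p ∂ν
      + ∫ p, stripSuperposition (fun _ => 1 / 2) (fun u => f u + f (u.1 + 1 / 2, u.2)) p ∂ν :=
    fun ν _ => (congrArg (fun g : ℝ × ℝ → ℝ => ∫ p, g p ∂ν) hrep).trans
      (integral_add (i1 ν) (i2 ν))
  rw [hsplit ν₁, hsplit ν₂, add_sub_add_comm]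
  refine (abs_add_le _ _).trans ((add_le_add b1 b2).trans ?_)
  rw [← add_mul]
  exact mul_le_mul_of_nonneg_right (by linarith) hD0

end Superposition

theorem exists_finset_forall_notMem {ι : Type*} [Fintype ι] {Ω : Set (ℝ × ℝ)}
    (hΩ : Bornology.IsBounded Ω) (t : ι → ℝ × ℝ) :
    ∃ M : Finset (ℤ × ℤ), ∀ j, ∀ m ∉ M, t j + ((m.1 : ℝ), (m.2 : ℝ)) ∉ Ω := by
  obtain ⟨R, hR⟩ := hΩ.exists_norm_le
  obtain ⟨K, hK⟩ := exists_nat_ge (R + ∑ j, ‖t j‖)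
  refine ⟨Finset.Icc (-(K : ℤ)) K ×ˢ Finset.Icc (-(K : ℤ)) K, fun j m hm hmem => hm ?_⟩
  have ht : ‖t j‖ ≤ ∑ j, ‖t j‖ :=
    Finset.single_le_sum (f := fun j => ‖t j‖) (fun _ _ => norm_nonneg _) (Finset.mem_univ j)
  have h : ‖((m.1 : ℝ), (m.2 : ℝ))‖ ≤ K := by
    have h1 := norm_sub_le (t j + ((m.1 : ℝ), (m.2 : ℝ))) (t j)
    rw [add_sub_cancel_left] at h1
    linarith [hR _ hmem]
  have h1 := (norm_fst_le _).trans h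
  have h2 := (norm_snd_le _).trans h
  simp only [Real.norm_eq_abs, abs_le] at h1 h2
  simp only [Finset.mem_product, Finset.mem_Icc]
  exact ⟨⟨by exact_mod_cast h1.1, by exact_mod_cast h1.2⟩,
    ⟨by exact_mod_cast h2.1, by exact_mod_cast h2.2⟩⟩

/-- The normalized sum over integer translates of the points in a bounded set is integration
against a finite measure. -/
theorem exists_measure_integral_eq_tsum {Ω : Set (ℝ × ℝ)} (hΩmeas : MeasurableSet Ω)
    (hΩ : Bornology.IsBounded Ω) (N : ℕ) (t : Fin N → ℝ × ℝ) :
    ∃ ν : Measure (ℝ × ℝ), IsFiniteMeasure ν ∧ ∀ g : ℝ × ℝ → ℝ,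
      ∫ p, g p ∂ν = (N : ℝ)⁻¹ * ∑ j, ∑' m : ℤ × ℤ,
        Ω.indicator g (t j + ((m.1 : ℝ), (m.2 : ℝ))) := by
  obtain ⟨M, hM⟩ := exists_finset_forall_notMem hΩ t
  refine ⟨((N : NNReal)⁻¹ • ∑ z ∈ Finset.univ ×ˢ M,
    Measure.dirac (t z.1 + ((z.2.1 : ℝ), (z.2.2 : ℝ)))).restrict Ω, inferInstance, fun g => ?_⟩
  rw [← integral_indicator hΩmeas, integral_smul_nnreal_measure, integral_finsetSum_measure
    fun _ _ => integrable_dirac (by simp), Finset.sum_product]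
  simp only [integral_dirac, NNReal.smul_def, smul_eq_mul, NNReal.coe_inv, NNReal.coe_natCast]
  congr 1
  refine Finset.sum_congr rfl fun j _ => (tsum_eq_sum fun m hm => ?_).symm
  exact Set.indicator_of_notMem (hM j m hm) g

/-- **Koksma–Hlawka type inequality for piecewise smooth functions** (Theorem 1):
if `h = f·χ_Ω` with `f` smooth and `ℤ²`-periodic and `Ω` a bounded Borel set, and `D` is
(an upper bound for) the discrepancy of `{t(j)}_{j=1}^N` relative to `Ω` measured over all
periodized rectangles `I(s,x)`, then
`|N⁻¹ ∑_j ∑_{m∈ℤ²} h(t(j)+m) − ∫_{ℝ²} h| ≤ V(f) · D`, where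
`V(f) = 4‖f‖₁ + 2‖∂₁f‖₁ + 2‖∂₂f‖₁ + ‖∂₁∂₂f‖₁` (L¹ norms over `[0,1]²`). -/
theorem koksma_hlawka_piecewise_smooth
    (f : ℝ × ℝ → ℝ) (hf : ContDiff ℝ (⊤ : ℕ∞) f)
    (hper : ∀ (x : ℝ × ℝ) (m : ℤ × ℤ), f (x + ((m.1 : ℝ), (m.2 : ℝ))) = f x)
    (Ω : Set (ℝ × ℝ)) (hΩmeas : MeasurableSet Ω) (hΩbdd : Bornology.IsBounded Ω)
    (N : ℕ) (hN : 0 < N) (t : Fin N → ℝ × ℝ) (D : ℝ)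
    (hD : ∀ s : ℝ × ℝ, 0 < s.1 → s.1 < 1 → 0 < s.2 → s.2 < 1 → ∀ x : ℝ × ℝ,
      |(N : ℝ)⁻¹ * ∑ j, ∑' m : ℤ × ℤ,
          (periodizedRect s x ∩ Ω).indicator (fun _ => (1 : ℝ))
            (t j + ((m.1 : ℝ), (m.2 : ℝ)))
        - (volume (periodizedRect s x ∩ Ω)).toReal| ≤ D) :
    |(N : ℝ)⁻¹ * ∑ j, ∑' m : ℤ × ℤ, Ω.indicator f (t j + ((m.1 : ℝ), (m.2 : ℝ)))
        - ∫ u, Ω.indicator f u|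
      ≤ ((4 * ∫ u in Set.Icc (0:ℝ) 1 ×ˢ Set.Icc (0:ℝ) 1, |f u|)
          + (2 * ∫ u in Set.Icc (0:ℝ) 1 ×ˢ Set.Icc (0:ℝ) 1, |fderiv ℝ f u (1, 0)|)
          + (2 * ∫ u in Set.Icc (0:ℝ) 1 ×ˢ Set.Icc (0:ℝ) 1, |fderiv ℝ f u (0, 1)|)
          + ∫ u in Set.Icc (0:ℝ) 1 ×ˢ Set.Icc (0:ℝ) 1,
              |fderiv ℝ (fun y => fderiv ℝ f y (1, 0)) u (0, 1)|) * D := by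
  obtain ⟨ν, hν, hint⟩ := exists_measure_integral_eq_tsum hΩmeas hΩbdd N t
  have : IsFiniteMeasure (volume.restrict Ω) :=
    isFiniteMeasure_restrict.2 hΩbdd.measure_lt_top.ne
  have hD' : ∀ s : ℝ × ℝ, 0 < s.1 → s.1 < 1 → 0 < s.2 → s.2 < 1 → ∀ x : ℝ × ℝ,
      |ν.real (periodizedRect s x) - (volume.restrict Ω).real (periodizedRect s x)| ≤ D := by
    intro s h1 h2 h3 h4 x
    have hm := measurableSet_periodizedRect s x
    have e : ν.real (periodizedRect s x)
        = ∫ p, (periodizedRect s x).indicator (fun _ => (1 : ℝ)) p ∂ν := by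
      rw [integral_indicator hm]
      simp
    rw [e, hint, Set.indicator_indicator, Set.inter_comm, measureReal_def,
      Measure.restrict_apply hm]
    exact hD s h1 h2 h3 h4 x
  have h := abs_integral_sub_integral_le_of_discrepancy_le hD' hf hper
  rw [hint, ← integral_indicator hΩmeas, unitMeasure_prod_unitMeasure] at h
  exact h
end

section
/- Let α, β ∈ ℝ, let i, j ≥ 0 be integers, and let δ > 0. Assume that for every pair of integers (m₁, m₂) ≠ (0,0) with |m₁| < 2^{i+1} and |m₂| < 2^{j+1}, one has ‖m₁α + m₂β‖ > δ. Then: (a) there is no pair of integers (n₁, n₂) with 2^i ≤ n₁ < 2^{i+1} and 2^j ≤ n₂ < 2^{j+1} such that ‖n₁α + n₂β‖ < δ; and (b) for every integer k ≥ 1, the number of pairs (n₁, n₂) with 2^i ≤ n₁ < 2^{i+1}, 2^j ≤ n₂ < 2^{j+1}, and (k−1)δ ≤ ‖n₁α + n₂β‖ < kδ is at most 2. -/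
open Real

/-- The distance from a real number to the nearest integer, `‖u‖ = |u − round u|`. -/
noncomputable def distToInt (u : ℝ) : ℝ := |u - round u|

theorem distToInt_sub_le (u v : ℝ) :
    distToInt (u - v) ≤ |(u - round u) - (v - round v)| := by
  have h := round_le (u - v) (round u - round v)
  have e : u - v - ((round u - round v : ℤ) : ℝ) = (u - round u) - (v - round v) := by
    push_cast
    ring
  rwa [e] at h

/-- If two reals lie at distance in `[a, a + δ)` from the nearest integer, on the same side of it,
then their difference is within `δ` of an integer. -/
theorem distToInt_sub_lt {u v a δ : ℝ} (hside : 0 ≤ u - round u ↔ 0 ≤ v - round v)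
    (hu : a ≤ distToInt u) (hu' : distToInt u < a + δ)
    (hv : a ≤ distToInt v) (hv' : distToInt v < a + δ) : distToInt (u - v) < δ := by
  refine (distToInt_sub_le u v).trans_lt ?_
  unfold distToInt at hu hu' hv hv'
  by_cases h : 0 ≤ u - round u
  · rw [abs_of_nonneg h] at hu hu'
    rw [abs_of_nonneg (hside.mp h)] at hv hv'
    rw [abs_lt]
    constructor <;> linarith
  · have h' : ¬ 0 ≤ v - round v := fun hv => h (hside.mpr hv)
    rw [abs_of_neg (not_le.mp h)] at hu hu'
    rw [abs_of_neg (not_le.mp h')] at hv hv'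
    rw [abs_lt]
    constructor <;> linarith

/-- **Spacing of the values `‖n₁α + n₂β‖`** (Davenport-type counting): if
`‖m₁α + m₂β‖ > δ` for all `(m₁,m₂) ≠ (0,0)` with `|m₁| < 2^{i+1}`, `|m₂| < 2^{j+1}`, then
(a) no `(n₁,n₂)` with `2^i ≤ n₁ < 2^{i+1}`, `2^j ≤ n₂ < 2^{j+1}` has `‖n₁α+n₂β‖ < δ`, and
(b) for every `k ≥ 1` at most two such pairs satisfy `(k−1)δ ≤ ‖n₁α+n₂β‖ < kδ`. -/
theorem spacing_of_linear_forms (α β : ℝ) (i j : ℕ) (δ : ℝ) (hδ : 0 < δ)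
    (H : ∀ m : ℤ × ℤ, m ≠ 0 → |m.1| < 2 ^ (i + 1) → |m.2| < 2 ^ (j + 1) →
      δ < distToInt ((m.1 : ℝ) * α + (m.2 : ℝ) * β)) :
    (¬ ∃ n : ℤ × ℤ, 2 ^ i ≤ n.1 ∧ n.1 < 2 ^ (i + 1) ∧ 2 ^ j ≤ n.2 ∧ n.2 < 2 ^ (j + 1) ∧
        distToInt ((n.1 : ℝ) * α + (n.2 : ℝ) * β) < δ)
    ∧ ∀ k : ℕ, 1 ≤ k →
      Set.ncard {n : ℤ × ℤ | 2 ^ i ≤ n.1 ∧ n.1 < 2 ^ (i + 1) ∧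
          2 ^ j ≤ n.2 ∧ n.2 < 2 ^ (j + 1) ∧
          ((k : ℝ) - 1) * δ ≤ distToInt ((n.1 : ℝ) * α + (n.2 : ℝ) * β) ∧
          distToInt ((n.1 : ℝ) * α + (n.2 : ℝ) * β) < (k : ℝ) * δ} ≤ 2 := by
  have hi : (0 : ℤ) < 2 ^ i := by positivity
  have hj : (0 : ℤ) < 2 ^ j := by positivity
  constructor
  · rintro ⟨n, h1, h2, h3, h4, h5⟩
    refine lt_asymm h5 (H n ?_ ?_ ?_)
    · rintro rfl
      exact absurd h1 (not_le.mpr hi)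
    · rwa [abs_of_pos (hi.trans_le h1)]
    · rwa [abs_of_pos (hj.trans_le h3)]
  · intro k _
    classical
    let side : ℤ × ℤ → Bool := fun n =>
      decide (0 ≤ ((n.1 : ℝ) * α + (n.2 : ℝ) * β) - round ((n.1 : ℝ) * α + (n.2 : ℝ) * β))
    have hcard : (Set.univ : Set Bool).ncard = 2 := by simp
    rw [← hcard]
    refine Set.ncard_le_ncard_of_injOn side (fun _ _ => Set.mem_univ _) ?_ Set.finite_univ
    rintro m ⟨m1, m2, m3, m4, m5, m6⟩ n ⟨n1, n2, n3, n4, n5, n6⟩ hside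
    by_contra hne
    have hlt := distToInt_sub_lt (decide_eq_decide.mp hside) m5
      (m6.trans_eq (by ring : (k : ℝ) * δ = ((k : ℝ) - 1) * δ + δ)) n5
      (n6.trans_eq (by ring))
    have hgt := H (m - n) (sub_ne_zero.mpr hne)
      (by rw [Prod.fst_sub, abs_lt]; constructor <;> linarith)
      (by rw [Prod.snd_sub, abs_lt]; constructor <;> linarith)
    have e : ((m - n).1 : ℝ) * α + ((m - n).2 : ℝ) * β =
        ((m.1 : ℝ) * α + (m.2 : ℝ) * β) - ((n.1 : ℝ) * α + (n.2 : ℝ) * β) := by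
      rw [Prod.fst_sub, Prod.snd_sub]
      push_cast
      ring
    rw [e] at hgt
    exact lt_asymm hlt hgt
end

section
/- Let α, β ∈ ℝ, let ε > 0 and γ > 0, and assume that for every (n₁, n₂) ∈ ℤ² with (n₁, n₂) ≠ (0,0), ‖n₁α + n₂β‖ > γ·(1+|n₁|)^{-1-ε}·(1+|n₂|)^{-1-ε}. Then there is a constant c, depending only on γ and ε, such that for all integers i, j ≥ 0, Σ_{n₁=2^i}^{2^{i+1}-1} Σ_{n₂=2^j}^{2^{j+1}-1} 1/‖n₁α + n₂β‖ ≤ c · 2^{(i+j)(1+ε)} · (1 + i + j). -/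
open Real

/-- Any integer is at least as far from `u` as the nearest one. -/
lemma distToInt_le_abs_sub_intCast (u : ℝ) (z : ℤ) : distToInt u ≤ |u - z| :=
  round_le u z

/-- A real number above a finite `δ`-separated family of positive reals is large. -/
lemma card_add_one_mul_le_of_separated {ι : Type*} (s : Finset ι) (f : ι → ℝ) (δ : ℝ)
    (hf : ∀ x ∈ s, δ ≤ f x) (hsep : ∀ x ∈ s, ∀ y ∈ s, x ≠ y → δ ≤ |f x - f y|) :
    ∀ b, δ ≤ b → (∀ x ∈ s, f x + δ ≤ b) → ((s.card : ℝ) + 1) * δ ≤ b := by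
  classical
  induction s using Finset.induction_on_max_value f with
  | empty => intro b hb _; simpa using hb
  | insert a s ha hmax ih =>
    intro b _ hb
    have hfa : ((s.card : ℝ) + 1) * δ ≤ f a := by
      refine ih (fun x hx => hf x (Finset.mem_insert_of_mem hx))
        (fun x hx y hy => hsep x (Finset.mem_insert_of_mem hx) y (Finset.mem_insert_of_mem hy))
        (f a) (hf a (Finset.mem_insert_self a s)) fun x hx => ?_
      have h := hsep a (Finset.mem_insert_self a s) x (Finset.mem_insert_of_mem hx)
        (by rintro rfl; exact ha hx)
      rw [abs_of_nonneg (sub_nonneg.2 (hmax x hx))] at h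
      linarith
    have hab := hb a (Finset.mem_insert_self a s)
    rw [Finset.card_insert_of_notMem ha]
    push_cast
    linarith

/-- The reciprocals of a finite `δ`-separated family of reals that are at least `δ` sum to at most
a harmonic number divided by `δ`. -/
lemma sum_inv_le_harmonic_of_separated {ι : Type*} (s : Finset ι) (f : ι → ℝ) (δ : ℝ)
    (hδ : 0 < δ) (hf : ∀ x ∈ s, δ ≤ f x)
    (hsep : ∀ x ∈ s, ∀ y ∈ s, x ≠ y → δ ≤ |f x - f y|) :
    ∑ x ∈ s, (f x)⁻¹ ≤ (harmonic s.card : ℝ) * δ⁻¹ := by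
  classical
  induction s using Finset.induction_on_max_value f with
  | empty => simp
  | insert a s ha hmax ih =>
    have hf' : ∀ x ∈ s, δ ≤ f x := fun x hx => hf x (Finset.mem_insert_of_mem hx)
    have hsep' : ∀ x ∈ s, ∀ y ∈ s, x ≠ y → δ ≤ |f x - f y| := fun x hx y hy =>
      hsep x (Finset.mem_insert_of_mem hx) y (Finset.mem_insert_of_mem hy)
    have hfa : ((s.card : ℝ) + 1) * δ ≤ f a := by
      refine card_add_one_mul_le_of_separated s f δ hf' hsep' (f a)
        (hf a (Finset.mem_insert_self a s)) fun x hx => ?_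
      have h := hsep a (Finset.mem_insert_self a s) x (Finset.mem_insert_of_mem hx)
        (by rintro rfl; exact ha hx)
      rw [abs_of_nonneg (sub_nonneg.2 (hmax x hx))] at h
      linarith
    have hinv : (f a)⁻¹ ≤ ((s.card : ℝ) + 1)⁻¹ * δ⁻¹ := by
      rw [← mul_inv]
      exact inv_anti₀ (by positivity) hfa
    rw [Finset.sum_insert ha, Finset.card_insert_of_notMem ha, harmonic_succ]
    push_cast
    linarith [ih hf' hsep']

/-- If the points `g x` are pairwise `δ`-separated modulo `1` and `δ`-far from the integers, then
the reciprocals of their distances to the integers sum to at most `2 (1 + log #s) / δ`. -/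
lemma sum_inv_distToInt_le_of_separated {ι : Type*} (s : Finset ι) (g : ι → ℝ) (δ : ℝ)
    (hδ : 0 < δ) (hg : ∀ x ∈ s, δ ≤ distToInt (g x))
    (hsep : ∀ x ∈ s, ∀ y ∈ s, x ≠ y → δ ≤ distToInt (g x - g y)) :
    ∑ x ∈ s, (distToInt (g x))⁻¹ ≤ 2 * (1 + Real.log s.card) * δ⁻¹ := by
  classical
  set f : ι → ℝ := fun x => g x - round (g x) with hfdef
  have hsepf : ∀ x ∈ s, ∀ y ∈ s, x ≠ y → δ ≤ |f x - f y| := fun x hx y hy hxy => by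
    refine (hsep x hx y hy hxy).trans
      ((distToInt_le_abs_sub_intCast _ (round (g x) - round (g y))).trans_eq ?_)
    simp only [hfdef]
    push_cast
    congr 1
    ring
  have harm : ∀ t ⊆ s, (harmonic t.card : ℝ) * δ⁻¹ ≤ (1 + Real.log s.card) * δ⁻¹ := fun t ht => by
    refine mul_le_mul_of_nonneg_right ?_ (by positivity)
    rcases t.eq_empty_or_nonempty with rfl | htne
    · have : 0 ≤ Real.log s.card := Real.log_natCast_nonneg _
      simp only [Finset.card_empty, harmonic_zero, Rat.cast_zero]
      linarith
    · have hle := Real.log_le_log (by exact_mod_cast htne.card_pos)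
        (show (t.card : ℝ) ≤ s.card by exact_mod_cast Finset.card_le_card ht)
      linarith [harmonic_le_one_add_log t.card]
  have hpos : ∑ x ∈ s with 0 ≤ f x, (distToInt (g x))⁻¹ ≤ (1 + Real.log s.card) * δ⁻¹ := by
    have hd : ∀ x ∈ s.filter (fun x => 0 ≤ f x), distToInt (g x) = f x := fun x hx =>
      abs_of_nonneg (Finset.mem_filter.1 hx).2
    rw [Finset.sum_congr rfl fun x hx => by rw [hd x hx]]
    refine (sum_inv_le_harmonic_of_separated _ f δ hδ (fun x hx => ?_) fun x hx y hy => ?_).trans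
      (harm _ (Finset.filter_subset _ _))
    · rw [← hd x hx]
      exact hg x (Finset.mem_filter.1 hx).1
    · exact hsepf x (Finset.mem_filter.1 hx).1 y (Finset.mem_filter.1 hy).1
  have hneg : ∑ x ∈ s with ¬ 0 ≤ f x, (distToInt (g x))⁻¹ ≤ (1 + Real.log s.card) * δ⁻¹ := by
    have hd : ∀ x ∈ s.filter (fun x => ¬ 0 ≤ f x), distToInt (g x) = -f x := fun x hx =>
      abs_of_neg (not_le.1 (Finset.mem_filter.1 hx).2)
    rw [Finset.sum_congr rfl fun x hx => by rw [hd x hx]]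
    refine (sum_inv_le_harmonic_of_separated _ (fun x => -f x) δ hδ (fun x hx => ?_)
      fun x hx y hy hxy => ?_).trans (harm _ (Finset.filter_subset _ _))
    · rw [← hd x hx]
      exact hg x (Finset.mem_filter.1 hx).1
    · rw [neg_sub_neg]
      exact hsepf y (Finset.mem_filter.1 hy).1 x (Finset.mem_filter.1 hx).1 hxy.symm
  rw [← Finset.sum_filter_add_sum_filter_not s (fun x => 0 ≤ f x)]
  linarith

/-- **Dyadic block estimate**: if `‖n₁α + n₂β‖ > γ(1+|n₁|)^{-1-ε}(1+|n₂|)^{-1-ε}` for all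
`(n₁,n₂) ≠ (0,0)`, then there is `c` depending only on `γ` and `ε` such that for all
`i, j ≥ 0`,
`∑_{n₁=2^i}^{2^{i+1}-1} ∑_{n₂=2^j}^{2^{j+1}-1} ‖n₁α+n₂β‖⁻¹ ≤ c·2^{(i+j)(1+ε)}(1+i+j)`. -/
theorem dyadic_block_sum_estimate (ε γ : ℝ) (hε : 0 < ε) (hγ : 0 < γ) :
    ∃ c > 0, ∀ α β : ℝ,
      (∀ n : ℤ × ℤ, n ≠ 0 →
        γ * (1 + |(n.1 : ℝ)|) ^ (-(1 + ε)) * (1 + |(n.2 : ℝ)|) ^ (-(1 + ε))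
          < distToInt ((n.1 : ℝ) * α + (n.2 : ℝ) * β)) →
      ∀ i j : ℕ,
        ∑ n₁ ∈ Finset.Ico (2 ^ i : ℕ) (2 ^ (i + 1)),
          ∑ n₂ ∈ Finset.Ico (2 ^ j : ℕ) (2 ^ (j + 1)),
            (distToInt ((n₁ : ℝ) * α + (n₂ : ℝ) * β))⁻¹
        ≤ c * (2 : ℝ) ^ (((i : ℝ) + (j : ℝ)) * (1 + ε)) * (1 + (i : ℝ) + (j : ℝ)) := by
  refine ⟨2 * γ⁻¹ * (2 : ℝ) ^ (2 * (1 + ε)), by positivity, fun α β h i j => ?_⟩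
  have hpow : ∀ (m : ℤ) (k : ℕ), |m| < 2 ^ (k + 1) →
      (2 : ℝ) ^ (-(((k : ℝ) + 1) * (1 + ε))) ≤ (1 + |(m : ℝ)|) ^ (-(1 + ε)) := fun m k hm => by
    have hle : 1 + |(m : ℝ)| ≤ (2 : ℝ) ^ ((k : ℝ) + 1) := by
      have : 1 + |m| ≤ 2 ^ (k + 1) := by omega
      rw [← Nat.cast_add_one, Real.rpow_natCast]
      exact_mod_cast this
    rw [← mul_neg, Real.rpow_mul (by norm_num)]
    exact Real.rpow_le_rpow_of_nonpos (by positivity) hle (by linarith)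
  set δ : ℝ := γ * (2 : ℝ) ^ (-(((i : ℝ) + 1) * (1 + ε))) * (2 : ℝ) ^ (-(((j : ℝ) + 1) * (1 + ε)))
    with hδdef
  have hδ : 0 < δ := by positivity
  have hδinv : δ⁻¹ = γ⁻¹ * (2 : ℝ) ^ (2 * (1 + ε)) * (2 : ℝ) ^ (((i : ℝ) + j) * (1 + ε)) := by
    rw [hδdef, mul_inv, mul_inv, ← Real.rpow_neg (by norm_num), ← Real.rpow_neg (by norm_num),
      mul_assoc, mul_assoc, ← Real.rpow_add (by norm_num), ← Real.rpow_add (by norm_num)]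
    congr 2
    ring
  have hfar : ∀ m n : ℤ, |m| < 2 ^ (i + 1) → |n| < 2 ^ (j + 1) → (m, n) ≠ 0 →
      δ ≤ distToInt ((m : ℝ) * α + (n : ℝ) * β) := fun m n hm hn hmn => by
    refine le_trans ?_ (h (m, n) hmn).le
    exact mul_le_mul (mul_le_mul_of_nonneg_left (hpow m i hm) hγ.le) (hpow n j hn)
      (by positivity) (by positivity)
  set s := Finset.Ico (2 ^ i : ℕ) (2 ^ (i + 1)) ×ˢ Finset.Ico (2 ^ j : ℕ) (2 ^ (j + 1)) with hs
  have htwo : ∀ k : ℕ, 2 ^ (k + 1) - 2 ^ k = 2 ^ k := fun k => by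
    rw [pow_succ, mul_two, Nat.add_sub_cancel]
  have hcard : s.card = 2 ^ (i + j) := by
    rw [hs, Finset.card_product, Nat.card_Ico, Nat.card_Ico, htwo, htwo, pow_add]
  have hmem : ∀ p ∈ s, (0 < p.1 ∧ (p.1 : ℤ) < 2 ^ (i + 1)) ∧
      (0 < p.2 ∧ (p.2 : ℤ) < 2 ^ (j + 1)) := fun p hp => by
    simp only [hs, Finset.mem_product, Finset.mem_Ico] at hp
    obtain ⟨⟨h1, h2⟩, h3, h4⟩ := hp
    exact ⟨⟨lt_of_lt_of_le (by positivity) h1, by exact_mod_cast h2⟩,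
      lt_of_lt_of_le (by positivity) h3, by exact_mod_cast h4⟩
  have key := sum_inv_distToInt_le_of_separated s
    (fun p : ℕ × ℕ => (p.1 : ℝ) * α + (p.2 : ℝ) * β) δ hδ
    (fun p hp => by
      obtain ⟨⟨h1, h2⟩, h3, h4⟩ := hmem p hp
      have := hfar p.1 p.2 (by rw [abs_of_nonneg] <;> omega) (by rw [abs_of_nonneg] <;> omega)
        (fun h0 => by simp only [Prod.mk_eq_zero] at h0; omega)
      simpa using this)
    (fun p hp q hq hpq => by
      obtain ⟨⟨h1, h2⟩, h3, h4⟩ := hmem p hp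
      obtain ⟨⟨h5, h6⟩, h7, h8⟩ := hmem q hq
      have := hfar ((p.1 : ℤ) - q.1) ((p.2 : ℤ) - q.2) (by rw [abs_lt]; omega)
        (by rw [abs_lt]; omega)
        (fun h0 => hpq (by
          simp only [Prod.mk_eq_zero] at h0
          exact Prod.ext (by omega) (by omega)))
      refine this.trans_eq (congrArg distToInt ?_)
      push_cast
      ring)
  rw [hs, Finset.sum_product, ← hs, hcard, hδinv] at key
  refine key.trans ?_
  have hlog : Real.log ((2 ^ (i + j) : ℕ) : ℝ) ≤ i + j := by
    push_cast
    rw [Real.log_pow]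
    push_cast
    exact mul_le_of_le_one_right (by positivity) (by linarith [Real.log_two_lt_d9])
  calc 2 * (1 + Real.log ((2 ^ (i + j) : ℕ) : ℝ)) *
        (γ⁻¹ * (2 : ℝ) ^ (2 * (1 + ε)) * (2 : ℝ) ^ (((i : ℝ) + j) * (1 + ε)))
      ≤ 2 * (1 + ((i : ℝ) + j)) *
        (γ⁻¹ * (2 : ℝ) ^ (2 * (1 + ε)) * (2 : ℝ) ^ (((i : ℝ) + j) * (1 + ε))) := by gcongr
    _ = _ := by ring
end

section
/- Let α, β ∈ ℝ and η > 0, and assume that for every (n₁, n₂) ∈ ℤ² with (n₁, n₂) ≠ (0,0), ‖n₁α + n₂β‖ > η / (max(|n₁|, |n₂|))². Then there is a constant c, depending only on η, such that for every integer i ≥ 0, Σ over pairs (n₁,n₂) ∈ ℤ² with 2^i ≤ max(|n₁|, |n₂|) < 2^{i+1} of 1/‖n₁α + n₂β‖ ≤ c · (1 + i) · 2^{2i}. -/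
open Real

/-- A positive `δ`-separated family bounded by `B` has reciprocal sum at most a harmonic sum. -/
theorem sum_inv_le_of_separated {ι : Type*} (s : Finset ι) (f : ι → ℝ) {δ B : ℝ} (hδ : 0 < δ)
    (hlo : ∀ n ∈ s, δ ≤ f n) (hhi : ∀ n ∈ s, f n ≤ B)
    (hsep : ∀ n ∈ s, ∀ m ∈ s, n ≠ m → δ ≤ |f n - f m|) :
    ∑ n ∈ s, (f n)⁻¹ ≤ δ⁻¹ * (1 + Real.log (⌊B / δ⌋₊ : ℝ)) := by
  classical
  have hfl : ∀ n ∈ s, 1 ≤ ⌊f n / δ⌋₊ := fun n hn =>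
    Nat.le_floor (by rw [Nat.cast_one, le_div_iff₀ hδ]; linarith [hlo n hn])
  have hle : ∀ n ∈ s, (⌊f n / δ⌋₊ : ℝ) * δ ≤ f n := fun n hn => by
    rw [← le_div_iff₀ hδ]
    exact Nat.floor_le (div_nonneg (hδ.le.trans (hlo n hn)) hδ.le)
  have hlt : ∀ n, f n < ((⌊f n / δ⌋₊ : ℝ) + 1) * δ := fun n => by
    rw [← div_lt_iff₀ hδ]
    exact Nat.lt_floor_add_one _
  have hinj : Set.InjOn (fun n => ⌊f n / δ⌋₊) s := by
    intro n hn m hm hnm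
    by_contra hne
    have h := hsep n hn m hm hne
    have h1 := hle n hn
    have h2 := hle m hm
    have h3 := hlt n
    have h4 := hlt m
    simp only at hnm
    rw [hnm] at h1 h3
    have : |f n - f m| < δ := abs_lt.mpr ⟨by linarith, by linarith⟩
    linarith
  calc ∑ n ∈ s, (f n)⁻¹ ≤ ∑ n ∈ s, δ⁻¹ * ((⌊f n / δ⌋₊ : ℝ))⁻¹ := by
        refine Finset.sum_le_sum fun n hn => ?_
        have h1 : (0 : ℝ) < ⌊f n / δ⌋₊ := by exact_mod_cast hfl n hn
        rw [← mul_inv, mul_comm δ]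
        exact inv_anti₀ (by positivity) (hle n hn)
    _ = ∑ k ∈ s.image (fun n => ⌊f n / δ⌋₊), δ⁻¹ * (k : ℝ)⁻¹ := by
        rw [Finset.sum_image hinj]
    _ ≤ ∑ k ∈ Finset.Icc 1 ⌊B / δ⌋₊, δ⁻¹ * (k : ℝ)⁻¹ := by
        refine Finset.sum_le_sum_of_subset_of_nonneg ?_ fun k _ _ => by positivity
        intro k hk
        obtain ⟨n, hn, rfl⟩ := Finset.mem_image.mp hk
        exact Finset.mem_Icc.mpr ⟨hfl n hn,
          Nat.floor_le_floor (div_le_div_of_nonneg_right (hhi n hn) hδ.le)⟩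
    _ = δ⁻¹ * ((harmonic ⌊B / δ⌋₊ : ℚ) : ℝ) := by
        rw [← Finset.mul_sum, harmonic_eq_sum_Icc]
        push_cast
        rfl
    _ ≤ _ := mul_le_mul_of_nonneg_left (harmonic_le_one_add_log _) (by positivity)

/-- The reciprocal distances to the nearest integer of a family that is `δ`-separated modulo `1`
and `δ`-away from the integers. -/
theorem sum_inv_distToInt_le {ι : Type*} (s : Finset ι) (u : ι → ℝ) {δ : ℝ} (hδ : 0 < δ)
    (hlo : ∀ n ∈ s, δ ≤ distToInt (u n))
    (hsep : ∀ n ∈ s, ∀ m ∈ s, n ≠ m → δ ≤ distToInt (u n - u m)) :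
    ∑ n ∈ s, (distToInt (u n))⁻¹ ≤ 2 * (δ⁻¹ * (1 + Real.log (⌊(1 / 2) / δ⌋₊ : ℝ))) := by
  classical
  rw [← Finset.sum_filter_add_sum_filter_not s (fun n => 0 ≤ u n - round (u n)), two_mul]
  refine add_le_add ?_ ?_ <;>
  · refine sum_inv_le_of_separated _ _ hδ (fun n hn => hlo n (Finset.mem_filter.mp hn).1)
      (fun n _ => abs_sub_round _) fun n hn m hm hne => ?_
    rw [Finset.mem_filter] at hn hm
    refine (hsep n hn.1 m hm.1 hne).trans ((distToInt_sub_le _ _).trans_eq ?_)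
    unfold distToInt
    first
    | rw [abs_of_nonneg hn.2, abs_of_nonneg hm.2]
    | rw [abs_of_neg (not_le.mp hn.2), abs_of_neg (not_le.mp hm.2), ← abs_neg]
      congr 1
      ring

/-- A lower bound `η / max(|n₁|,|n₂|)²` is uniform on nonzero points of a box. -/
theorem le_distToInt_of_abs_le {η α β M : ℝ} (hη : 0 < η)
    (h : ∀ n : ℤ × ℤ, n ≠ 0 →
        η / ((max |(n.1 : ℝ)| |(n.2 : ℝ)|) ^ 2)
          < distToInt ((n.1 : ℝ) * α + (n.2 : ℝ) * β))
    {n : ℤ × ℤ} (hn : n ≠ 0) (h1 : |(n.1 : ℝ)| ≤ M) (h2 : |(n.2 : ℝ)| ≤ M) :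
    η / M ^ 2 ≤ distToInt ((n.1 : ℝ) * α + (n.2 : ℝ) * β) := by
  refine le_trans ?_ (h n hn).le
  have hpos : 0 < max |(n.1 : ℝ)| |(n.2 : ℝ)| := by
    by_contra hc
    have hc := not_lt.mp hc
    refine hn (Prod.ext ?_ ?_)
    · exact_mod_cast abs_nonpos_iff.mp ((le_max_left _ _).trans hc)
    · exact_mod_cast abs_nonpos_iff.mp ((le_max_right _ _).trans hc)
  exact div_le_div_of_nonneg_left hη.le (by positivity)
    (pow_le_pow_left₀ hpos.le (max_le h1 h2) 2)

/-- **Dyadic annulus estimate under a cubic Liouville-type bound**: if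
`‖n₁α + n₂β‖ > η / max(|n₁|,|n₂|)²` for all `(n₁,n₂) ≠ (0,0)`, then there is `c`
depending only on `η` such that for every `i ≥ 0`,
`∑_{2^i ≤ max(|n₁|,|n₂|) < 2^{i+1}} ‖n₁α+n₂β‖⁻¹ ≤ c (1+i) 2^{2i}`. -/
theorem dyadic_annulus_sum_estimate (η : ℝ) (hη : 0 < η) :
    ∃ c > 0, ∀ α β : ℝ,
      (∀ n : ℤ × ℤ, n ≠ 0 →
        η / ((max |(n.1 : ℝ)| |(n.2 : ℝ)|) ^ 2)
          < distToInt ((n.1 : ℝ) * α + (n.2 : ℝ) * β)) →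
      ∀ i : ℕ,
        ∑' n : {n : ℤ × ℤ // 2 ^ i ≤ max |n.1| |n.2| ∧ max |n.1| |n.2| < 2 ^ (i + 1)},
          (distToInt ((n.1.1 : ℝ) * α + (n.1.2 : ℝ) * β))⁻¹
        ≤ c * (1 + (i : ℝ)) * 2 ^ (2 * i) := by
  have hL : 0 < Real.log (2 / η + 1) := Real.log_pos (by linarith [div_pos two_pos hη])
  refine ⟨32 * (3 + Real.log (2 / η + 1)) / η, by positivity, fun α β h i => ?_⟩
  set L := Real.log (2 / η + 1)
  set M : ℝ := 2 ^ (i + 1) with hM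
  have hMpos : 0 < M := by positivity
  have hδ : 0 < η / (2 * M) ^ 2 := by positivity
  have hbox : ∀ n : {n : ℤ × ℤ // 2 ^ i ≤ max |n.1| |n.2| ∧ max |n.1| |n.2| < 2 ^ (i + 1)},
      |(n.1.1 : ℝ)| ≤ M ∧ |(n.1.2 : ℝ)| ≤ M := fun n => by
    have h1 := (le_max_left _ _).trans n.2.2.le
    have h2 := (le_max_right _ _).trans n.2.2.le
    exact ⟨by rw [hM]; exact_mod_cast h1, by rw [hM]; exact_mod_cast h2⟩
  have hlog : Real.log (⌊(1 / 2) / (η / (2 * M) ^ 2)⌋₊ : ℝ) ≤ 2 * (i + 1) + L := by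
    rcases Nat.eq_zero_or_pos ⌊(1 / 2) / (η / (2 * M) ^ 2)⌋₊ with h0 | h0
    · rw [h0, Nat.cast_zero, Real.log_zero]
      positivity
    · have hK : (⌊(1 / 2) / (η / (2 * M) ^ 2)⌋₊ : ℝ) ≤ M ^ 2 * (2 / η + 1) := by
        refine (Nat.floor_le (by positivity)).trans ?_
        have : (1 / 2) / (η / (2 * M) ^ 2) = M ^ 2 * (2 / η) := by
          field_simp
        rw [this, mul_add]
        linarith [sq_nonneg M]
      refine (Real.log_le_log (by exact_mod_cast h0) hK).trans ?_
      rw [Real.log_mul (by positivity) (by positivity), Real.log_pow, hM, Real.log_pow]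
      have h2 : Real.log 2 ≤ 1 := by linarith [Real.log_two_lt_d9]
      have h3 : ((i + 1 : ℕ) : ℝ) * Real.log 2 ≤ ((i + 1 : ℕ) : ℝ) :=
        mul_le_of_le_one_right (by positivity) h2
      push_cast at h3 ⊢
      linarith
  refine tsum_le_of_sum_le' (by positivity) fun s => ?_
  refine (sum_inv_distToInt_le s
    (fun n => (n.1.1 : ℝ) * α + (n.1.2 : ℝ) * β) hδ ?_ ?_).trans ?_
  · intro n _
    obtain ⟨h1, h2⟩ := hbox n
    refine le_distToInt_of_abs_le hη h (fun h0 => ?_) (by linarith) (by linarith)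
    have h3 := n.2.1
    rw [h0] at h3
    have : (0 : ℤ) < 2 ^ i := by positivity
    simp at h3
    linarith
  · intro n _ m _ hne
    obtain ⟨h1, h2⟩ := hbox n
    obtain ⟨h3, h4⟩ := hbox m
    have h5 := le_distToInt_of_abs_le (M := 2 * M) hη h (n := n.1 - m.1)
      (sub_ne_zero.mpr fun h0 => hne (Subtype.ext h0))
      (by rw [Prod.fst_sub, Int.cast_sub]; linarith [abs_sub (n.1.1 : ℝ) m.1.1])
      (by rw [Prod.snd_sub, Int.cast_sub]; linarith [abs_sub (n.1.2 : ℝ) m.1.2])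
    rw [Prod.fst_sub, Prod.snd_sub, Int.cast_sub, Int.cast_sub] at h5
    convert h5 using 2
    ring
  · have hM2 : M ^ 2 = 4 * 2 ^ (2 * i) := by
      rw [hM]
      ring
    calc 2 * ((η / (2 * M) ^ 2)⁻¹ * (1 + Real.log (⌊(1 / 2) / (η / (2 * M) ^ 2)⌋₊ : ℝ)))
        ≤ 2 * ((η / (2 * M) ^ 2)⁻¹ * ((3 + L) * (1 + i))) := by
          gcongr
          nlinarith [mul_nonneg hL.le (Nat.cast_nonneg (α := ℝ) i), Nat.cast_nonneg (α := ℝ) i]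
      _ = 32 * (3 + L) / η * (1 + i) * 2 ^ (2 * i) := by
          rw [mul_pow, hM2]
          field_simp
          ring
end

section
/- Let α, β ∈ ℝ and η > 0, and assume that for every (n₁, n₂) ∈ ℤ² with (n₁, n₂) ≠ (0,0), ‖n₁α + n₂β‖ > η / (max(|n₁|, |n₂|))². Then there is a constant c, depending only on η, such that for every real R ≥ 2, Σ_{n=(n₁,n₂)∈ℤ², 0<|n|<R} |n|^{-3/2} · (1/‖n₁α + n₂β‖) ≤ c · R^{1/2} · log R. -/
open Real

lemma distToInt_nonneg (u : ℝ) : 0 ≤ distToInt u := abs_nonneg _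

/-- Points of the orbit `n₁α + n₂β` with `n` in a box of side `N` are `η / (2N)²`-separated
modulo one, so the sum of `‖n₁α + n₂β‖⁻¹` is at most twice a harmonic sum. -/
lemma sum_inv_distToInt_le_s16 {η α β : ℝ} (hη : 0 < η)
    (h : ∀ n : ℤ × ℤ, n ≠ 0 → η / ((max |(n.1 : ℝ)| |(n.2 : ℝ)|) ^ 2)
      < distToInt ((n.1 : ℝ) * α + (n.2 : ℝ) * β))
    {N : ℝ} (hN : 1 ≤ N) (s : Finset (ℤ × ℤ))
    (hs : ∀ n ∈ s, n ≠ 0 ∧ |(n.1 : ℝ)| ≤ N ∧ |(n.2 : ℝ)| ≤ N) :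
    ∑ n ∈ s, (distToInt ((n.1 : ℝ) * α + (n.2 : ℝ) * β))⁻¹
      ≤ 8 * N ^ 2 / η * (1 + Real.log (2 * N ^ 2 / η)) := by
  have lower : ∀ (M : ℝ) (n : ℤ × ℤ), n ≠ 0 → |(n.1 : ℝ)| ≤ M → |(n.2 : ℝ)| ≤ M →
      η / M ^ 2 < distToInt ((n.1 : ℝ) * α + (n.2 : ℝ) * β) := by
    intro M n hn h1 h2
    refine lt_of_le_of_lt ?_ (h n hn)
    have hpos : 0 < max |(n.1 : ℝ)| |(n.2 : ℝ)| := by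
      by_contra! hle
      apply hn
      have h3 := abs_nonpos_iff.1 ((le_max_left _ _).trans hle)
      have h4 := abs_nonpos_iff.1 ((le_max_right _ _).trans hle)
      exact Prod.ext (by exact_mod_cast h3) (by exact_mod_cast h4)
    have := max_le h1 h2
    gcongr
  have upper : ∀ u, distToInt u ≤ 1 / 2 := abs_sub_round
  have hη2 : η ≤ 1 / 2 := by
    have := lower 1 (1, 0) (by simp) (by simp) (by simp)
    have h' := upper (((1, 0) : ℤ × ℤ).1 * α + ((1, 0) : ℤ × ℤ).2 * β)
    norm_num at this h' ⊢
    linarith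
  have hN2 : 1 ≤ N ^ 2 := one_le_pow₀ hN
  set δ := η / (2 * N) ^ 2 with hδ
  have hδ0 : 0 < δ := by positivity
  set x : ℤ × ℤ → ℝ := fun n ↦ (n.1 : ℝ) * α + (n.2 : ℝ) * β with hx
  set K := ⌊2 * N ^ 2 / η⌋₊ with hK
  have hδK : 1 / 2 / δ = 2 * N ^ 2 / η := by rw [hδ]; field_simp
  have hk : ∀ n ∈ s, 1 ≤ ⌊distToInt (x n) / δ⌋₊ := by
    intro n hn
    obtain ⟨h0, h1, h2⟩ := hs n hn
    apply Nat.le_floor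
    have := lower (2 * N) n h0 (by linarith) (by linarith)
    rw [le_div_iff₀ hδ0]
    simpa using this.le
  have hinj : Set.InjOn (fun n ↦ (⌊distToInt (x n) / δ⌋₊, decide (0 ≤ x n - round (x n))))
      (s : Set (ℤ × ℤ)) := by
    intro n hn m hm hnm
    by_contra hne
    simp only [Prod.mk.injEq, decide_eq_decide] at hnm
    obtain ⟨hf, hsg⟩ := hnm
    obtain ⟨-, h1, h2⟩ := hs n hn
    obtain ⟨-, h3, h4⟩ := hs m hm
    have hsep := lower (2 * N) (n - m) (sub_ne_zero.2 hne)
      (by push_cast [Prod.fst_sub]; exact (abs_sub _ _).trans (by linarith))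
      (by push_cast [Prod.snd_sub]; exact (abs_sub _ _).trans (by linarith))
    have hle := round_le (x n - x m) (round (x n) - round (x m))
    have hxx : (((n - m).1 : ℤ) : ℝ) * α + (((n - m).2 : ℤ) : ℝ) * β = x n - x m := by
      simp only [hx, Prod.fst_sub, Prod.snd_sub]; push_cast; ring
    rw [hxx] at hsep
    change distToInt (x n - x m) ≤ _ at hle
    push_cast at hle
    have hclose : |distToInt (x n) / δ - distToInt (x m) / δ| < 1 := by
      have a1 := Nat.floor_le (div_nonneg (distToInt_nonneg (x n)) hδ0.le)
      have a2 := Nat.lt_floor_add_one (distToInt (x n) / δ)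
      have a3 := Nat.floor_le (div_nonneg (distToInt_nonneg (x m)) hδ0.le)
      have a4 := Nat.lt_floor_add_one (distToInt (x m) / δ)
      rw [hf] at a1 a2
      rw [abs_lt]; constructor <;> linarith
    rw [← sub_div, abs_div, abs_of_pos hδ0, div_lt_one hδ0] at hclose
    have heq : |x n - x m - (round (x n) - round (x m))| = |distToInt (x n) - distToInt (x m)| := by
      have : x n - x m - ((round (x n) : ℝ) - round (x m))
        = (x n - round (x n)) - (x m - round (x m)) := by ring
      rw [this]
      unfold distToInt
      by_cases hp : 0 ≤ x n - round (x n)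
      · rw [abs_of_nonneg hp, abs_of_nonneg (hsg.1 hp)]
      · have hq := fun hq ↦ hp (hsg.2 hq)
        rw [abs_of_neg (not_le.1 hp), abs_of_neg (not_le.1 hq), ← abs_neg]
        congr 1; ring
    linarith
  calc ∑ n ∈ s, (distToInt (x n))⁻¹
      ≤ ∑ n ∈ s, ((⌊distToInt (x n) / δ⌋₊ : ℝ)⁻¹ / δ) := by
        refine Finset.sum_le_sum fun n hn ↦ ?_
        have h1 : (1 : ℝ) ≤ ⌊distToInt (x n) / δ⌋₊ := by exact_mod_cast hk n hn
        have h2 := Nat.floor_le (div_nonneg (distToInt_nonneg (x n)) hδ0.le)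
        rw [le_div_iff₀ hδ0] at h2
        rw [← one_div, div_eq_mul_inv _ δ, ← mul_inv, one_div]
        gcongr
    _ = ∑ p ∈ s.image (fun n ↦ (⌊distToInt (x n) / δ⌋₊, decide (0 ≤ x n - round (x n)))),
          ((p.1 : ℝ)⁻¹ / δ) := by rw [Finset.sum_image hinj]
    _ ≤ ∑ p ∈ Finset.Icc 1 K ×ˢ (Finset.univ : Finset Bool), ((p.1 : ℝ)⁻¹ / δ) := by
        refine Finset.sum_le_sum_of_subset_of_nonneg ?_ fun _ _ _ ↦ by positivity
        intro p hp
        obtain ⟨n, hn, rfl⟩ := Finset.mem_image.1 hp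
        simp only [Finset.mem_product, Finset.mem_Icc, Finset.mem_univ, and_true]
        refine ⟨hk n hn, ?_⟩
        rw [hK, ← hδK]
        have := upper (x n)
        gcongr
    _ = 2 / δ * ∑ k ∈ Finset.Icc 1 K, (k : ℝ)⁻¹ := by
        rw [Finset.sum_product, Finset.mul_sum]
        refine Finset.sum_congr rfl fun k _ ↦ ?_
        simp
        ring
    _ ≤ 2 / δ * (1 + Real.log (2 * N ^ 2 / η)) := by
        have := harmonic_floor_le_one_add_log (2 * N ^ 2 / η)
          (by rw [le_div_iff₀ hη]; linarith)
        rw [harmonic_eq_sum_Icc] at this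
        push_cast at this
        gcongr
    _ = _ := by rw [hδ]; field_simp; ring

/-- The nonzero lattice points of sup-norm at most `N`. -/
noncomputable def puncturedBox (N : ℕ) : Finset (ℤ × ℤ) :=
  (Finset.Icc (-(N : ℤ)) N ×ˢ Finset.Icc (-(N : ℤ)) N).erase 0

lemma mem_puncturedBox {N : ℕ} {n : ℤ × ℤ} :
    n ∈ puncturedBox N ↔ n ≠ 0 ∧ |(n.1 : ℝ)| ≤ N ∧ |(n.2 : ℝ)| ≤ N := by
  simp only [puncturedBox, Finset.mem_erase, Finset.mem_product, Finset.mem_Icc, ← abs_le]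
  norm_cast

/-- Dyadic summation: quadratic growth of the sum of `f` over boxes gives growth of order `N^(1/2)`
of the sum weighted by `|n|^(-3/2)`. -/
lemma sum_puncturedBox_rpow_mul_le {f : ℤ × ℤ → ℝ} (hf : ∀ n, 0 ≤ f n) {A : ℝ} (hA : 0 ≤ A)
    (J : ℕ) (h : ∀ j ≤ J, ∑ n ∈ puncturedBox (2 ^ j), f n ≤ A * ((2 : ℝ) ^ j) ^ 2) :
    ∑ n ∈ puncturedBox (2 ^ J),
        Real.sqrt ((n.1 : ℝ) ^ 2 + (n.2 : ℝ) ^ 2) ^ (-(3 : ℝ) / 2) * f n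
      ≤ 12 * A * ((2 : ℝ) ^ J) ^ ((1 : ℝ) / 2) := by
  have weight : ∀ (M : ℝ) (n : ℤ × ℤ), 0 < M → (M ≤ |(n.1 : ℝ)| ∨ M ≤ |(n.2 : ℝ)|) →
      Real.sqrt ((n.1 : ℝ) ^ 2 + (n.2 : ℝ) ^ 2) ^ (-(3 : ℝ) / 2) ≤ M ^ (-(3 : ℝ) / 2) := by
    intro M n hM hn
    refine Real.rpow_le_rpow_of_nonpos hM ?_ (by norm_num)
    rcases hn with hn | hn
    · exact hn.trans (Real.abs_le_sqrt (by nlinarith [sq_nonneg (n.2 : ℝ)]))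
    · exact hn.trans (Real.abs_le_sqrt (by nlinarith [sq_nonneg (n.1 : ℝ)]))
  induction J with
  | zero =>
    have h0 := h 0 le_rfl
    simp only [pow_zero, one_pow, mul_one, Real.one_rpow] at h0 ⊢
    refine (Finset.sum_le_sum fun n hn ↦ ?_).trans (h0.trans (by linarith))
    have hn0 := (mem_puncturedBox.1 hn).1
    have := weight 1 n one_pos (by
      by_contra! hlt
      apply hn0
      have h1 : |n.1| < 1 := by exact_mod_cast hlt.1
      have h2 : |n.2| < 1 := by exact_mod_cast hlt.2
      exact Prod.ext (Int.abs_lt_one_iff.1 h1) (Int.abs_lt_one_iff.1 h2))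
    rw [Real.one_rpow] at this
    exact mul_le_of_le_one_left (hf n) this
  | succ j ih =>
    have ih := ih fun i hi ↦ h i (by omega)
    set q : ℝ := (2 : ℝ) ^ j with hq
    have hq0 : 0 < q := by positivity
    have hsub : puncturedBox (2 ^ j) ⊆ puncturedBox (2 ^ (j + 1)) := by
      intro n hn
      rw [mem_puncturedBox] at hn ⊢
      push_cast [pow_succ] at hn ⊢
      exact ⟨hn.1, by linarith [hn.2.1], by linarith [hn.2.2]⟩
    have hshell : ∑ n ∈ puncturedBox (2 ^ (j + 1)) \ puncturedBox (2 ^ j),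
        Real.sqrt ((n.1 : ℝ) ^ 2 + (n.2 : ℝ) ^ 2) ^ (-(3 : ℝ) / 2) * f n
        ≤ 4 * A * q ^ ((1 : ℝ) / 2) := by
      calc _ ≤ ∑ n ∈ puncturedBox (2 ^ (j + 1)) \ puncturedBox (2 ^ j),
            q ^ (-(3 : ℝ) / 2) * f n := by
            refine Finset.sum_le_sum fun n hn ↦ ?_
            rw [Finset.mem_sdiff, mem_puncturedBox, mem_puncturedBox] at hn
            refine mul_le_mul_of_nonneg_right (weight q n hq0 ?_) (hf n)
            by_contra! hlt
            refine hn.2 ⟨hn.1.1, ?_⟩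
            push_cast
            exact ⟨hlt.1.le, hlt.2.le⟩
        _ ≤ ∑ n ∈ puncturedBox (2 ^ (j + 1)), q ^ (-(3 : ℝ) / 2) * f n :=
            Finset.sum_le_sum_of_subset_of_nonneg Finset.sdiff_subset
              fun n _ _ ↦ mul_nonneg (by positivity) (hf n)
        _ ≤ q ^ (-(3 : ℝ) / 2) * (A * ((2 : ℝ) ^ (j + 1)) ^ 2) := by
            rw [← Finset.mul_sum]
            have := h (j + 1) le_rfl
            gcongr
        _ = 4 * A * (q ^ (-(3 : ℝ) / 2) * q ^ (2 : ℝ)) := by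
            rw [Real.rpow_two, hq]; ring
        _ = _ := by rw [← Real.rpow_add hq0]; norm_num
    rw [← Finset.sum_sdiff hsub]
    have h2 : (1.4 : ℝ) ≤ 2 ^ ((1 : ℝ) / 2) := by
      rw [← Real.sqrt_eq_rpow]
      exact Real.le_sqrt_of_sq_le (by norm_num)
    rw [pow_succ (2 : ℝ) j, ← hq, Real.mul_rpow hq0.le two_pos.le]
    have := mul_le_mul_of_nonneg_left h2
      (mul_nonneg hA (Real.rpow_nonneg hq0.le ((1 : ℝ) / 2)))
    nlinarith [mul_nonneg hA (Real.rpow_nonneg hq0.le ((1 : ℝ) / 2))]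

/-- **Lattice sum estimate with weight `|n|^{-3/2}`**: if
`‖n₁α + n₂β‖ > η / max(|n₁|,|n₂|)²` for all `(n₁,n₂) ≠ (0,0)`, then there is `c`
depending only on `η` such that for every `R ≥ 2`,
`∑_{0<|n|<R} |n|^{-3/2} ‖n₁α+n₂β‖⁻¹ ≤ c · R^{1/2} · log R`. -/
theorem lattice_sum_estimate_three_halves (η : ℝ) (hη : 0 < η) :
    ∃ c > 0, ∀ α β : ℝ,
      (∀ n : ℤ × ℤ, n ≠ 0 →
        η / ((max |(n.1 : ℝ)| |(n.2 : ℝ)|) ^ 2)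
          < distToInt ((n.1 : ℝ) * α + (n.2 : ℝ) * β)) →
      ∀ R : ℝ, 2 ≤ R →
        ∑' n : {n : ℤ × ℤ // n ≠ 0 ∧ Real.sqrt ((n.1 : ℝ) ^ 2 + (n.2 : ℝ) ^ 2) < R},
          Real.sqrt ((n.1.1 : ℝ) ^ 2 + (n.1.2 : ℝ) ^ 2) ^ (-(3:ℝ)/2)
            * (distToInt ((n.1.1 : ℝ) * α + (n.1.2 : ℝ) * β))⁻¹
        ≤ c * R ^ ((1:ℝ)/2) * Real.log R := by
  have hlog2 : 0 < Real.log 2 := Real.log_pos one_lt_two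
  set D := 2 + (1 + |Real.log (8 / η)|) / Real.log 2 with hD
  have hD0 : 0 < D := by positivity
  refine ⟨12 * (8 / η * D) * 2, by positivity, fun α β h R hR ↦ ?_⟩
  set f : ℤ × ℤ → ℝ := fun n ↦ (distToInt ((n.1 : ℝ) * α + (n.2 : ℝ) * β))⁻¹
  have hf : ∀ n, 0 ≤ f n := fun n ↦ inv_nonneg.2 (distToInt_nonneg _)
  have hR0 : 0 < R := by linarith
  have hlogR : Real.log 2 ≤ Real.log R := Real.log_le_log two_pos hR
  have hlogR0 : 0 < Real.log R := hlog2.trans_le hlogR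
  obtain ⟨k, hk1, hk2⟩ := exists_nat_pow_near (show 1 ≤ R by linarith) one_lt_two
  have hk3 : (2 : ℝ) ^ (k + 1) ≤ 2 * R := by rw [pow_succ]; linarith
  have hlog : 1 + Real.log (8 * R ^ 2 / η) ≤ D * Real.log R := by
    have h1 : Real.log (8 * R ^ 2 / η) = Real.log (8 / η) + 2 * Real.log R := by
      rw [mul_div_right_comm, Real.log_mul (by positivity) (by positivity), Real.log_pow]
      norm_num
    have h2 : 1 + |Real.log (8 / η)| ≤ (1 + |Real.log (8 / η)|) / Real.log 2 * Real.log R := by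
      rw [div_mul_eq_mul_div, le_div_iff₀ hlog2]
      gcongr
    rw [h1, hD, add_mul]
    linarith [le_abs_self (Real.log (8 / η))]
  have hbox : ∀ j ≤ k + 1, ∑ n ∈ puncturedBox (2 ^ j), f n
      ≤ 8 / η * (D * Real.log R) * ((2 : ℝ) ^ j) ^ 2 := by
    intro j hj
    have hj1 : (1 : ℝ) ≤ 2 ^ j := one_le_pow₀ one_le_two
    have hjR : (2 : ℝ) ^ j ≤ 2 * R := (pow_le_pow_right₀ one_le_two hj).trans hk3
    refine (sum_inv_distToInt_le_s16 hη h hj1 _ fun n hn ↦ ?_).trans ?_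
    · simpa using mem_puncturedBox.1 hn
    · have hmono : 1 + Real.log (2 * ((2 : ℝ) ^ j) ^ 2 / η) ≤ D * Real.log R := by
        refine le_trans ?_ hlog
        have : 2 * ((2 : ℝ) ^ j) ^ 2 ≤ 8 * R ^ 2 := by nlinarith
        gcongr
      calc _ ≤ 8 * ((2 : ℝ) ^ j) ^ 2 / η * (D * Real.log R) := by gcongr
        _ = _ := by ring
  have hsum := sum_puncturedBox_rpow_mul_le hf (by positivity) (k + 1) hbox
  have hfinal : 12 * (8 / η * (D * Real.log R)) * ((2 : ℝ) ^ (k + 1)) ^ ((1 : ℝ) / 2)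
      ≤ 12 * (8 / η * D) * 2 * R ^ ((1 : ℝ) / 2) * Real.log R := by
    have h1 : ((2 : ℝ) ^ (k + 1)) ^ ((1 : ℝ) / 2) ≤ 2 * R ^ ((1 : ℝ) / 2) := by
      calc ((2 : ℝ) ^ (k + 1)) ^ ((1 : ℝ) / 2) ≤ (2 * R) ^ ((1 : ℝ) / 2) := by gcongr
        _ = 2 ^ ((1 : ℝ) / 2) * R ^ ((1 : ℝ) / 2) := Real.mul_rpow two_pos.le hR0.le
        _ ≤ _ := by
          gcongr
          exact Real.rpow_le_self_of_one_le one_le_two (by norm_num)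
    calc _ ≤ 12 * (8 / η * (D * Real.log R)) * (2 * R ^ ((1 : ℝ) / 2)) := by gcongr
      _ = _ := by ring
  refine Real.tsum_le_of_sum_le (fun n ↦ mul_nonneg (by positivity) (hf n.1)) fun u ↦ ?_
  refine le_trans ?_ (hsum.trans hfinal)
  refine le_of_eq_of_le (Finset.sum_map u (Function.Embedding.subtype _)
    (fun n : ℤ × ℤ ↦ Real.sqrt ((n.1 : ℝ) ^ 2 + (n.2 : ℝ) ^ 2) ^ (-(3 : ℝ) / 2) * f n)).symm ?_
  refine Finset.sum_le_sum_of_subset_of_nonneg ?_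
    fun n _ _ ↦ mul_nonneg (by positivity) (hf n)
  intro n hn
  obtain ⟨⟨m, hm0, hmR⟩, -, rfl⟩ := Finset.mem_map.1 hn
  rw [mem_puncturedBox]
  have hlt := hmR.trans hk2
  change m ≠ 0 ∧ |(m.1 : ℝ)| ≤ _ ∧ |(m.2 : ℝ)| ≤ _
  push_cast
  exact ⟨hm0, (Real.abs_le_sqrt (by nlinarith [sq_nonneg (m.2 : ℝ)])).trans hlt.le,
    (Real.abs_le_sqrt (by nlinarith [sq_nonneg (m.1 : ℝ)])).trans hlt.le⟩
end
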